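/- Let (Π_n)_{n≥1} be a sequence of partitions of [0,T] with mesh |Π_n| → 0 such that the lower value functions V^{Π_n} converge uniformly on compact subsets of [0,T] × ℝ^d to a function V. Then V is a viscosity subsolution of the Hamilton–Jacobi–Isaacs equation ∂_t W(t,x) + sup_{μ ∈ ΔU} inf_{ν ∈ ΔV} f̃(t,x,μ,ν)·∇W(t,x) = 0 with terminal condition W(T,·) = g. -/

import Mathlib

open MeasureTheory Set Filter Topology
open scoped unitInterval RealInnerProductSpace ENNReal NNReal

noncomputable section

namespace DGameFormal

/-! ### The canonical sample space `Ω = ([0,1]²)^ℕ` -/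

/-- The sample space `Ω = ([0,1]²)^ℕ`.  The `j`-th coordinate mapping `ζ_{j+1}` of the paper is
`ω ↦ ω j` (we use `0`-based indexing, so the paper's `ζ_j`, `j ≥ 1`, is `ω ↦ ω (j-1)`). -/
abbrev Omega : Type := ℕ → (I × I)

/-- `𝓕_j`: the σ-field generated by the first `j` coordinate mappings `ζ_1, …, ζ_j`. -/
def Fsig (j : ℕ) : MeasurableSpace Omega :=
  MeasurableSpace.comap (fun ω (i : Fin j) => ω (i : ℕ)) inferInstance

/-- `𝓖_{j+1}`: the σ-field generated by the first component of the coordinate `ζ_{j+1}`. -/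
def Gsig (j : ℕ) : MeasurableSpace Omega :=
  MeasurableSpace.comap (fun ω => (ω j).1) inferInstance

/-- `𝓗_{j+1}`: the σ-field generated by the second component of the coordinate `ζ_{j+1}`. -/
def Hsig (j : ℕ) : MeasurableSpace Omega :=
  MeasurableSpace.comap (fun ω => (ω j).2) inferInstance

/-- `P` is the countable product `λ₂^{⊗ℕ}` of the two-dimensional Lebesgue (Borel) measure on the
unit square: it has the prescribed finite-dimensional distributions. -/
def IsProductMeasure (P : Measure Omega) : Prop :=
  ∀ m : ℕ, P.map (fun ω (i : Fin m) => ω (i : ℕ))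
      = Measure.pi (fun _ : Fin m => (volume : Measure (I × I)))

/-! ### Partitions of `[0,T]` -/

/-- A partition `0 = t_0 < t_1 < ⋯ < t_n = T` of the interval `[0,T]`. -/
structure Partition (T : ℝ) where
  n : ℕ
  npos : 0 < n
  t : ℕ → ℝ
  map_zero : t 0 = 0
  map_last : t n = T
  mono : ∀ i < n, t i < t (i + 1)

/-- The mesh `|Π|`: the maximal distance between two neighbouring points of the partition. -/
def Partition.mesh {T : ℝ} (π : Partition T) : ℝ :=
  (Finset.range π.n).sup' (Finset.nonempty_range_iff.2 π.npos.ne') fun i => π.t (i + 1) - π.t i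

open scoped Classical in
/-- For `t ∈ [t_i, t_{i+1})` the index `i` (and `n - 1` for `t ≥ t_{n-1}`). -/
def Partition.idx {T : ℝ} (π : Partition T) (s : ℝ) : ℕ :=
  Nat.findGreatest (fun i => π.t i ≤ s) (π.n - 1)

/-! ### Admissible controls along a partition -/

variable (U V : Type) [MeasurableSpace U] [MeasurableSpace V]

/-- Admissible controls for Player 1 along the partition `π`: measurable processes `u` such that on
each interval `[t_{j-1}, t_j)` of the partition, `u` is a countable sum `Σ_k 1_{Γ_{j,k}} u^{j,k}`
where `(Γ_{j,k})_k ⊆ 𝓕_{j-1}` is a partition of `Ω` and each `u^{j,k}` is `𝓖_j`-measurable. -/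
def AdmControl1 {T : ℝ} (π : Partition T) : Set (ℝ → Omega → U) :=
  {u | Measurable (Function.uncurry u) ∧
    ∀ j < π.n, ∃ (Γ : ℕ → Set Omega) (w : ℕ → ℝ → Omega → U),
      (∀ k, MeasurableSet[Fsig j] (Γ k)) ∧
      Pairwise (Function.onFun Disjoint Γ) ∧
      (⋃ k, Γ k) = univ ∧
      (∀ k s, Measurable[Gsig j] (w k s)) ∧
      (∀ k, ∀ ω ∈ Γ k, ∀ s ∈ Ico (π.t j) (π.t (j + 1)), u s ω = w k s ω)}

/-- Admissible controls for Player 2 along the partition `π` (with `𝓗_j` in place of `𝓖_j`). -/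
def AdmControl2 {T : ℝ} (π : Partition T) : Set (ℝ → Omega → V) :=
  {v | Measurable (Function.uncurry v) ∧
    ∀ j < π.n, ∃ (Γ : ℕ → Set Omega) (w : ℕ → ℝ → Omega → V),
      (∀ k, MeasurableSet[Fsig j] (Γ k)) ∧
      Pairwise (Function.onFun Disjoint Γ) ∧
      (⋃ k, Γ k) = univ ∧
      (∀ k s, Measurable[Hsig j] (w k s)) ∧
      (∀ k, ∀ ω ∈ Γ k, ∀ s ∈ Ico (π.t j) (π.t (j + 1)), v s ω = w k s ω)}

/-! ### Nonanticipative strategies with delay (NAD strategies) -/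

/-- A stopping time `τ : Ω → {0, 1, …, n-1}` of the discrete filtration `(𝓕_j)_j`. -/
def IsStoppingIdx {T : ℝ} (π : Partition T) (τ : Omega → ℕ) : Prop :=
  (∀ ω, τ ω < π.n) ∧ ∀ j, MeasurableSet[Fsig j] {ω | τ ω = j}

variable {U V}

/-- `u = u'`, `ds⊗dP`-a.e. on the stochastic interval `[[t, b]] = {(s,ω) | t ≤ s ≤ b ω}`. -/
def aeStEq {α : Type*} (P : Measure Omega) (t : ℝ) (b : Omega → ℝ)
    (u u' : ℝ → Omega → α) : Prop :=
  ∀ᵐ p ∂((volume : Measure ℝ).prod P), t ≤ p.1 → p.1 ≤ b p.2 → u p.1 p.2 = u' p.1 p.2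

/-- `u = u'`, `ds⊗dP`-a.e. on `[a,b] × Ω`. -/
def aeEqIcc {α : Type*} (P : Measure Omega) (a b : ℝ) (u u' : ℝ → Omega → α) : Prop :=
  ∀ᵐ p ∂((volume : Measure ℝ).prod P), p.1 ∈ Icc a b → u p.1 p.2 = u' p.1 p.2

variable (U V)

/-- NAD strategies for Player 1 on `[t,T]` along `π`: maps from admissible controls of Player 2 to
admissible controls of Player 1 such that controls agreeing `ds⊗dP`-a.e. on `[[t, t_τ]]`, for a
stopping time `τ`, are mapped to controls agreeing `ds⊗dP`-a.e. on `[[t, t_{τ+1}]]`. -/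
def IsNAD1 {T : ℝ} (P : Measure Omega) (π : Partition T) (t : ℝ)
    (α : (ℝ → Omega → V) → (ℝ → Omega → U)) : Prop :=
  (∀ v ∈ AdmControl2 V π, α v ∈ AdmControl1 U π) ∧
  ∀ τ : Omega → ℕ, IsStoppingIdx π τ →
    ∀ v v', v ∈ AdmControl2 V π → v' ∈ AdmControl2 V π →
      aeStEq P t (fun ω => π.t (τ ω)) v v' →
      aeStEq P t (fun ω => π.t (τ ω + 1)) (α v) (α v')

/-- NAD strategies for Player 2 on `[t,T]` along `π`. -/
def IsNAD2 {T : ℝ} (P : Measure Omega) (π : Partition T) (t : ℝ)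
    (β : (ℝ → Omega → U) → (ℝ → Omega → V)) : Prop :=
  (∀ u ∈ AdmControl1 U π, β u ∈ AdmControl2 V π) ∧
  ∀ τ : Omega → ℕ, IsStoppingIdx π τ →
    ∀ u u', u ∈ AdmControl1 U π → u' ∈ AdmControl1 U π →
      aeStEq P t (fun ω => π.t (τ ω)) u u' →
      aeStEq P t (fun ω => π.t (τ ω + 1)) (β u) (β u')

/-! ### The controlled dynamics -/

variable {U V}
variable {d : ℕ}

/-- `X` is the (continuous) solution on `[t,T]` of `X_s = x + ∫_t^s f(r, X_r, u_r, v_r) dr`. -/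
def IsSol (f : ℝ → EuclideanSpace ℝ (Fin d) → U → V → EuclideanSpace ℝ (Fin d)) (T t : ℝ)
    (x : EuclideanSpace ℝ (Fin d)) (u : ℝ → U) (v : ℝ → V)
    (X : ℝ → EuclideanSpace ℝ (Fin d)) : Prop :=
  ContinuousOn X (Icc t T) ∧ ∀ s ∈ Icc t T, X s = x + ∫ r in t..s, f r (X r) (u r) (v r)

/-- The solution `X^{t,x,u,v}` (chosen via the axiom of choice; under the standing assumptions it
is the unique continuous solution). -/
def sol (f : ℝ → EuclideanSpace ℝ (Fin d) → U → V → EuclideanSpace ℝ (Fin d)) (T t : ℝ)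
    (x : EuclideanSpace ℝ (Fin d)) (u : ℝ → U) (v : ℝ → V) : ℝ → EuclideanSpace ℝ (Fin d) :=
  Classical.epsilon (IsSol f T t x u v)

/-- `(u,v)` is the couple of admissible controls associated with the couple of NAD strategies
`(α,β)` on `[t, tl]`:  `α(v) = u` and `β(u) = v`, `ds⊗dP`-a.e. on `[t,tl] × Ω`. -/
def IsFixPair {T : ℝ} (P : Measure Omega) (π : Partition T) (t tl : ℝ)
    (α : (ℝ → Omega → V) → (ℝ → Omega → U)) (β : (ℝ → Omega → U) → (ℝ → Omega → V))
    (u : ℝ → Omega → U) (v : ℝ → Omega → V) : Prop :=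
  u ∈ AdmControl1 U π ∧ v ∈ AdmControl2 V π ∧ aeEqIcc P t tl (α v) u ∧ aeEqIcc P t tl (β u) v

variable [Nonempty U] [Nonempty V]

/-- The couple of admissible controls associated with a couple of NAD strategies on `[t,tl]`
(chosen via the axiom of choice; by Lemma 2.1 it exists and is `ds⊗dP`-a.e. unique). -/
def fixPair {T : ℝ} (P : Measure Omega) (π : Partition T) (t tl : ℝ)
    (α : (ℝ → Omega → V) → (ℝ → Omega → U)) (β : (ℝ → Omega → U) → (ℝ → Omega → V)) :
    (ℝ → Omega → U) × (ℝ → Omega → V) :=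
  Classical.epsilon fun p => IsFixPair P π t tl α β p.1 p.2

/-- The state process `X^{t,x,α,β}` associated with a couple of NAD strategies on `[t,tl]`. -/
def solStrat (f : ℝ → EuclideanSpace ℝ (Fin d) → U → V → EuclideanSpace ℝ (Fin d)) {T : ℝ}
    (P : Measure Omega) (π : Partition T) (t tl : ℝ) (x : EuclideanSpace ℝ (Fin d))
    (α : (ℝ → Omega → V) → (ℝ → Omega → U)) (β : (ℝ → Omega → U) → (ℝ → Omega → V))
    (s : ℝ) (ω : Omega) : EuclideanSpace ℝ (Fin d) :=
  sol f T t x (fun r => (fixPair P π t tl α β).1 r ω) (fun r => (fixPair P π t tl α β).2 r ω) s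

/-- The terminal pay-off `g(X_T^{t,x,α,β})`. -/
def payoff (f : ℝ → EuclideanSpace ℝ (Fin d) → U → V → EuclideanSpace ℝ (Fin d))
    (g : EuclideanSpace ℝ (Fin d) → ℝ) {T : ℝ} (P : Measure Omega) (π : Partition T)
    (t : ℝ) (x : EuclideanSpace ℝ (Fin d))
    (α : (ℝ → Omega → V) → (ℝ → Omega → U)) (β : (ℝ → Omega → U) → (ℝ → Omega → V)) :
    Omega → ℝ :=
  fun ω => g (solStrat f P π t T x α β T ω)

/-! ### Essential suprema/infima of families of random variables -/

/-- `S` is the `P`-a.s. least upper bound of the family `(ξ_i)_{i}` of random variables. -/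
def IsEssSupFam {ι : Sort*} (P : Measure Omega) (ξ : ι → Omega → ℝ) (S : Omega → ℝ) : Prop :=
  (∀ i, ξ i ≤ᵐ[P] S) ∧ ∀ W : Omega → ℝ, (∀ i, ξ i ≤ᵐ[P] W) → S ≤ᵐ[P] W

/-- `S` is the `P`-a.s. greatest lower bound of the family `(ξ_i)_{i}` of random variables. -/
def IsEssInfFam {ι : Sort*} (P : Measure Omega) (ξ : ι → Omega → ℝ) (S : Omega → ℝ) : Prop :=
  (∀ i, S ≤ᵐ[P] ξ i) ∧ ∀ W : Omega → ℝ, (∀ i, W ≤ᵐ[P] ξ i) → W ≤ᵐ[P] S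

/-! ### Value functions along a partition -/

variable (U V)

/-- The defining property of the lower value function along `π`:
`S = esssup_{α} essinf_{β} E[g(X_T^{t,x,α,β}) | 𝓕_i]` for `t_i ≤ t < t_{i+1}`. -/
def IsLowerVal (f : ℝ → EuclideanSpace ℝ (Fin d) → U → V → EuclideanSpace ℝ (Fin d))
    (g : EuclideanSpace ℝ (Fin d) → ℝ) {T : ℝ} (P : Measure Omega) (π : Partition T)
    (t : ℝ) (x : EuclideanSpace ℝ (Fin d)) (S : Omega → ℝ) : Prop :=
  ∃ J : {α // IsNAD1 U V P π t α} → Omega → ℝ,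
    (∀ α, IsEssInfFam P
      (fun β : {β // IsNAD2 U V P π t β} => P[payoff f g P π t x α.1 β.1 | Fsig (π.idx t)])
      (J α)) ∧
    IsEssSupFam P J S

/-- The defining property of the upper value function along `π`. -/
def IsUpperVal (f : ℝ → EuclideanSpace ℝ (Fin d) → U → V → EuclideanSpace ℝ (Fin d))
    (g : EuclideanSpace ℝ (Fin d) → ℝ) {T : ℝ} (P : Measure Omega) (π : Partition T)
    (t : ℝ) (x : EuclideanSpace ℝ (Fin d)) (S : Omega → ℝ) : Prop :=
  ∃ J : {β // IsNAD2 U V P π t β} → Omega → ℝ,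
    (∀ β, IsEssSupFam P
      (fun α : {α // IsNAD1 U V P π t α} => P[payoff f g P π t x α.1 β.1 | Fsig (π.idx t)])
      (J β)) ∧
    IsEssInfFam P J S

/-- The lower value function along `π` seen as a random variable. -/
def lowerVal (f : ℝ → EuclideanSpace ℝ (Fin d) → U → V → EuclideanSpace ℝ (Fin d))
    (g : EuclideanSpace ℝ (Fin d) → ℝ) {T : ℝ} (P : Measure Omega) (π : Partition T)
    (t : ℝ) (x : EuclideanSpace ℝ (Fin d)) : Omega → ℝ :=
  Classical.epsilon (IsLowerVal U V f g P π t x)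

/-- The upper value function along `π` seen as a random variable. -/
def upperVal (f : ℝ → EuclideanSpace ℝ (Fin d) → U → V → EuclideanSpace ℝ (Fin d))
    (g : EuclideanSpace ℝ (Fin d) → ℝ) {T : ℝ} (P : Measure Omega) (π : Partition T)
    (t : ℝ) (x : EuclideanSpace ℝ (Fin d)) : Omega → ℝ :=
  Classical.epsilon (IsUpperVal U V f g P π t x)

/-- The (deterministic) lower value function along `π`: the expectation of `lowerVal`. -/
def lowerValD (f : ℝ → EuclideanSpace ℝ (Fin d) → U → V → EuclideanSpace ℝ (Fin d))
    (g : EuclideanSpace ℝ (Fin d) → ℝ) {T : ℝ} (P : Measure Omega) (π : Partition T)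
    (t : ℝ) (x : EuclideanSpace ℝ (Fin d)) : ℝ :=
  ∫ ω, lowerVal U V f g P π t x ω ∂P

/-- The (deterministic) upper value function along `π`: the expectation of `upperVal`. -/
def upperValD (f : ℝ → EuclideanSpace ℝ (Fin d) → U → V → EuclideanSpace ℝ (Fin d))
    (g : EuclideanSpace ℝ (Fin d) → ℝ) {T : ℝ} (P : Measure Omega) (π : Partition T)
    (t : ℝ) (x : EuclideanSpace ℝ (Fin d)) : ℝ :=
  ∫ ω, upperVal U V f g P π t x ω ∂P

/-! ### The Hamiltonian and viscosity solutions -/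

section Hamiltonian

variable (U V : Type) [MetricSpace U] [MetricSpace V] [MeasurableSpace U] [MeasurableSpace V]

/-- `f̃(t,x,μ,ν) = ∫_U ∫_V f(t,x,u,v) μ(du) ν(dv)` for mixed actions `μ ∈ Δ(U)`, `ν ∈ Δ(V)`. -/
def ftilde (f : ℝ → EuclideanSpace ℝ (Fin d) → U → V → EuclideanSpace ℝ (Fin d))
    (t : ℝ) (x : EuclideanSpace ℝ (Fin d)) (μ : ProbabilityMeasure U) (ν : ProbabilityMeasure V) :
    EuclideanSpace ℝ (Fin d) :=
  ∫ u, ∫ v, f t x u v ∂(ν : Measure V) ∂(μ : Measure U)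

/-- The Hamiltonian `sup_{μ ∈ ΔU} inf_{ν ∈ ΔV} f̃(t,x,μ,ν)·p`. -/
def ham (f : ℝ → EuclideanSpace ℝ (Fin d) → U → V → EuclideanSpace ℝ (Fin d))
    (t : ℝ) (x p : EuclideanSpace ℝ (Fin d)) : ℝ :=
  ⨆ μ : ProbabilityMeasure U, ⨅ ν : ProbabilityMeasure V, ⟪ftilde U V f t x μ ν, p⟫

/-- Viscosity subsolution of `∂_t W + sup_μ inf_ν f̃(t,x,μ,ν)·∇W = 0`, `W(T,·) = g`, on
`[0,T] × ℝ^d`. -/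
def IsViscSubsol (f : ℝ → EuclideanSpace ℝ (Fin d) → U → V → EuclideanSpace ℝ (Fin d))
    (g : EuclideanSpace ℝ (Fin d) → ℝ) (T : ℝ) (W : ℝ → EuclideanSpace ℝ (Fin d) → ℝ) : Prop :=
  (∀ x, W T x ≤ g x) ∧
  ∀ φ : ℝ → EuclideanSpace ℝ (Fin d) → ℝ,
    ContDiff ℝ 1 (fun q : ℝ × EuclideanSpace ℝ (Fin d) => φ q.1 q.2) →
    ∀ t x, t ∈ Ico (0 : ℝ) T →
      IsLocalMaxOn (fun q : ℝ × EuclideanSpace ℝ (Fin d) => W q.1 q.2 - φ q.1 q.2)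
        (Icc (0 : ℝ) T ×ˢ univ) (t, x) →
      0 ≤ deriv (fun s => φ s x) t + ham U V f t x (gradient (fun y => φ t y) x)

/-- Viscosity supersolution of `∂_t W + sup_μ inf_ν f̃(t,x,μ,ν)·∇W = 0`, `W(T,·) = g`, on
`[0,T] × ℝ^d`. -/
def IsViscSupersol (f : ℝ → EuclideanSpace ℝ (Fin d) → U → V → EuclideanSpace ℝ (Fin d))
    (g : EuclideanSpace ℝ (Fin d) → ℝ) (T : ℝ) (W : ℝ → EuclideanSpace ℝ (Fin d) → ℝ) : Prop :=
  (∀ x, g x ≤ W T x) ∧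
  ∀ φ : ℝ → EuclideanSpace ℝ (Fin d) → ℝ,
    ContDiff ℝ 1 (fun q : ℝ × EuclideanSpace ℝ (Fin d) => φ q.1 q.2) →
    ∀ t x, t ∈ Ico (0 : ℝ) T →
      IsLocalMinOn (fun q : ℝ × EuclideanSpace ℝ (Fin d) => W q.1 q.2 - φ q.1 q.2)
        (Icc (0 : ℝ) T ×ˢ univ) (t, x) →
      deriv (fun s => φ s x) t + ham U V f t x (gradient (fun y => φ t y) x) ≤ 0

end Hamiltonian

end DGameFormal

namespace DGameFormal

section Ode

set_option linter.unusedSectionVars false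

variable {E : Type*} [NormedAddCommGroup E] [NormedSpace ℝ E] [CompleteSpace E]
  [MeasurableSpace E] [BorelSpace E] [SecondCountableTopology E]

/-- `X` is a continuous solution on `[a, c]` of the integral equation
`X_s = x + ∫_a^s b(r, X_r) dr`. -/
def IsIntSol (b : ℝ → E → E) (a c : ℝ) (x : E) (X : ℝ → E) : Prop :=
  ContinuousOn X (Icc a c) ∧ ∀ s ∈ Icc a c, X s = x + ∫ r in a..s, b r (X r)

/-- Picard iterates of the integral equation `X_s = x + ∫_a^s b(r, X_r) dr`. -/
def picard (b : ℝ → E → E) (a : ℝ) (x : E) : ℕ → ℝ → E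
  | 0, _ => x
  | m + 1, s => x + ∫ r in Ioc a s, b r (picard b a x m r)

theorem measurable_picard {Ω' : Type*} {m0 : MeasurableSpace Ω'} {b : Ω' → ℝ → E → E}
    (hb : Measurable fun p : Ω' × ℝ × E => b p.1 p.2.1 p.2.2) (a : ℝ) (x : E) (m : ℕ) :
    Measurable fun p : Ω' × ℝ => picard (b p.1) a x m p.2 := by
  induction m with
  | zero => exact measurable_const
  | succ m ih =>
    refine measurable_const.add ?_
    have h1 : Measurable fun q : (Ω' × ℝ) × ℝ =>
        b q.1.1 q.2 (picard (b q.1.1) a x m q.2) :=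
      hb.comp ((measurable_fst.comp measurable_fst).prodMk (measurable_snd.prodMk
        (ih.comp ((measurable_fst.comp measurable_fst).prodMk measurable_snd))))
    have hS : MeasurableSet {q : (Ω' × ℝ) × ℝ | a < q.2 ∧ q.2 ≤ q.1.2} :=
      (measurableSet_lt measurable_const measurable_snd).inter
        (measurableSet_le measurable_snd (measurable_snd.comp measurable_fst))
    have h2 := ((h1.indicator hS).stronglyMeasurable.integral_prod_right'
      (ν := (volume : Measure ℝ))).measurable
    convert h2 using 1
    funext p
    rw [← integral_indicator measurableSet_Ioc]
    rfl

variable {b : ℝ → E → E} {C : ℝ} {K : ℝ≥0}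

theorem intervalIntegrable_of_bdd {X : ℝ → E} {a c : ℝ}
    (hb : Measurable fun q : ℝ × E => b q.1 q.2) (hC : ∀ r y, ‖b r y‖ ≤ C) (hac : a ≤ c)
    (hX : AEMeasurable X (volume.restrict (Ioc a c))) :
    IntervalIntegrable (fun r => b r (X r)) volume a c := by
  rw [intervalIntegrable_iff_integrableOn_Ioc_of_le hac]
  exact Integrable.of_bound
    (hb.comp_aemeasurable (aemeasurable_id.prodMk hX)).aestronglyMeasurable C
    (Eventually.of_forall fun r => hC _ _)

theorem aemeasurable_of_continuousOn_Icc {X : ℝ → E} {a c : ℝ} (hX : ContinuousOn X (Icc a c)) :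
    AEMeasurable X (volume.restrict (Ioc a c)) :=
  (hX.mono Ioc_subset_Icc_self).aemeasurable measurableSet_Ioc

theorem IsIntSol.norm_sub_le {a c : ℝ} {x y : E} {X Y : ℝ → E}
    (hb : Measurable fun q : ℝ × E => b q.1 q.2) (hC : ∀ r y, ‖b r y‖ ≤ C)
    (hK : ∀ r, LipschitzWith K (b r))
    (hX : IsIntSol b a c x X) (hY : IsIntSol b a c y Y) {s : ℝ} (hs : s ∈ Icc a c) :
    ‖X s - Y s‖ ≤ ‖x - y‖ * Real.exp (K * (s - a)) := by
  have hac : a ≤ c := hs.1.trans hs.2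
  set D : ℝ → ℝ := IccExtend hac (fun r : Icc a c => ‖X r - Y r‖) with hD
  have hDc : Continuous D :=
    (continuousOn_iff_continuous_domRestrict.1 (hX.1.sub hY.1).norm).Icc_extend'
  have hDe : ∀ r ∈ Icc a c, D r = ‖X r - Y r‖ := fun r hr => by
    rw [hD, IccExtend_of_mem _ _ hr]
  set G : ℝ → ℝ := fun s => ‖x - y‖ + K * ∫ r in a..s, D r with hG
  have hGd : ∀ s, HasDerivAt G (K * D s) s := fun s =>
    ((intervalIntegral.integral_hasDerivAt_right (hDc.intervalIntegrable _ _)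
      (hDc.stronglyMeasurableAtFilter _ _) hDc.continuousAt).const_mul (K : ℝ)).const_add _
  have hle : ∀ s ∈ Icc a c, D s ≤ G s := by
    intro s hs
    have hi : ∀ {Z : ℝ → E}, ContinuousOn Z (Icc a c) →
        IntervalIntegrable (fun r => b r (Z r)) volume a s := fun hZ =>
      intervalIntegrable_of_bdd hb hC hs.1
        (aemeasurable_of_continuousOn_Icc (hZ.mono (Icc_subset_Icc_right hs.2)))
    have e : X s - Y s = (x - y) + ∫ r in a..s, (b r (X r) - b r (Y r)) := by
      rw [hX.2 s hs, hY.2 s hs, intervalIntegral.integral_sub (hi hX.1) (hi hY.1)]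
      abel
    rw [hDe s hs, e]
    refine (norm_add_le _ _).trans (add_le_add le_rfl ?_)
    rw [← intervalIntegral.integral_const_mul]
    refine intervalIntegral.norm_integral_le_of_norm_le hs.1 (Eventually.of_forall ?_)
      ((hDc.const_mul (K : ℝ)).intervalIntegrable _ _)
    intro r hr
    rw [hDe r ⟨hr.1.le, hr.2.trans hs.2⟩, ← dist_eq_norm, ← dist_eq_norm]
    exact (hK r).dist_le_mul _ _
  have hG0 : ∀ s ∈ Icc a c, 0 ≤ G s := fun s hs =>
    ((hDe s hs).symm ▸ norm_nonneg _ : 0 ≤ D s).trans (hle s hs)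
  have := norm_le_gronwallBound_of_norm_deriv_right_le (f := G) (f' := fun s => K * D s)
    (δ := ‖x - y‖) (K := K) (ε := 0) (a := a) (b := c)
    (fun s _ => (hGd s).continuousAt.continuousWithinAt)
    (fun s _ => (hGd s).hasDerivWithinAt)
    (by simp [hG])
    (fun s hs => by
      have hs' := Ico_subset_Icc_self hs
      rw [Real.norm_of_nonneg (hG0 s hs'), add_zero, Real.norm_of_nonneg]
      · exact mul_le_mul_of_nonneg_left (hle s hs') K.2
      · exact mul_nonneg K.2 (by rw [hDe s hs']; positivity)) s hs
  rw [gronwallBound_ε0, Real.norm_of_nonneg (hG0 s hs)] at this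
  rw [← hDe s hs]
  exact (hle s hs).trans this

theorem norm_picard_succ_sub_le {a : ℝ} {x : E}
    (hb : Measurable fun q : ℝ × E => b q.1 q.2) (hC : ∀ r y, ‖b r y‖ ≤ C)
    (hK : ∀ r, LipschitzWith K (b r)) (m : ℕ) {s : ℝ} (hs : a ≤ s) :
    ‖picard b a x (m + 1) s - picard b a x m s‖ ≤
      C / 2 ^ m * Real.exp ((2 * K + 1) * (s - a)) := by
  have hC0 : 0 ≤ C := (norm_nonneg _).trans (hC 0 x)
  have hK0 : (0 : ℝ) ≤ K := K.2
  have hm : ∀ m, Measurable fun r => picard b a x m r := fun m =>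
    (measurable_picard (b := fun _ : Unit => b) (hb.comp measurable_snd) a x m).comp
      (measurable_const.prodMk measurable_id : Measurable fun r : ℝ => ((), r))
  induction m generalizing s with
  | zero =>
    have e : picard b a x 1 s - picard b a x 0 s = ∫ r in a..s, b r (picard b a x 0 r) := by
      rw [intervalIntegral.integral_of_le hs]; simp [picard]
    rw [e]
    have h1 := intervalIntegral.norm_integral_le_of_norm_le_const
      (f := fun r => b r (picard b a x 0 r)) (a := a) (b := s) (C := C) (fun r _ => hC _ _)
    refine h1.trans ?_
    rw [abs_of_nonneg (sub_nonneg.2 hs), pow_zero, div_one]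
    refine mul_le_mul_of_nonneg_left ?_ hC0
    have := Real.add_one_le_exp ((2 * (K : ℝ) + 1) * (s - a))
    nlinarith [mul_nonneg hK0 (sub_nonneg.2 hs)]
  | succ m ih =>
    have hi : ∀ m, IntervalIntegrable (fun r => b r (picard b a x m r)) volume a s := fun m =>
      intervalIntegrable_of_bdd hb hC hs (hm m).aemeasurable
    have e : picard b a x (m + 1 + 1) s - picard b a x (m + 1) s =
        ∫ r in a..s, (b r (picard b a x (m + 1) r) - b r (picard b a x m r)) := by
      rw [intervalIntegral.integral_sub (hi _) (hi _), intervalIntegral.integral_of_le hs,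
        intervalIntegral.integral_of_le hs]
      simp [picard]
    rw [e]
    have hd : ∀ r, HasDerivAt
        (fun r => C / 2 ^ m * K / (2 * K + 1) * Real.exp ((2 * K + 1) * (r - a)))
        (K * (C / 2 ^ m * Real.exp ((2 * K + 1) * (r - a)))) r := fun r => by
      have := ((((hasDerivAt_id r).sub_const a).const_mul (2 * (K : ℝ) + 1)).exp).const_mul
        (C / 2 ^ m * K / (2 * K + 1))
      refine this.congr_deriv ?_
      simp only [id_eq, mul_one]
      field_simp
    have hcont : Continuous fun r => K * (C / 2 ^ m * Real.exp ((2 * K + 1) * (r - a))) := by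
      fun_prop
    have h1 : ‖∫ r in a..s, (b r (picard b a x (m + 1) r) - b r (picard b a x m r))‖ ≤
        ∫ r in a..s, K * (C / 2 ^ m * Real.exp ((2 * K + 1) * (r - a))) := by
      refine intervalIntegral.norm_integral_le_of_norm_le hs (Eventually.of_forall ?_)
        (hcont.intervalIntegrable _ _)
      intro r hr
      refine le_trans ?_ (mul_le_mul_of_nonneg_left (ih hr.1.le) hK0)
      rw [← dist_eq_norm, ← dist_eq_norm]
      exact (hK r).dist_le_mul _ _
    refine h1.trans ?_
    rw [intervalIntegral.integral_eq_sub_of_hasDerivAt (fun r _ => hd r)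
      (hcont.intervalIntegrable _ _)]
    have h2 : C / 2 ^ m * K / (2 * K + 1) ≤ C / 2 ^ (m + 1) := by
      rw [div_le_iff₀ (by positivity), pow_succ]
      have : 0 ≤ C / 2 ^ m := by positivity
      have e2 : C / (2 ^ m * 2) = C / 2 ^ m / 2 := by field_simp
      rw [e2]; nlinarith
    have h3 : 0 ≤ C / 2 ^ m * K / (2 * K + 1) := by positivity
    have h4 := Real.exp_pos ((2 * K + 1) * (s - a))
    have h5 := Real.exp_pos ((2 * (K : ℝ) + 1) * (a - a))
    nlinarith [mul_le_mul_of_nonneg_right h2 h4.le, mul_nonneg h3 h5.le]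

theorem exists_isIntSol_picard (a c : ℝ) (x : E)
    (hb : Measurable fun q : ℝ × E => b q.1 q.2) (hC : ∀ r y, ‖b r y‖ ≤ C)
    (hK : ∀ r, LipschitzWith K (b r)) :
    ∃ X : ℝ → E, IsIntSol b a c x X ∧
      ∀ s ∈ Icc a c, Tendsto (fun m => picard b a x m s) atTop (𝓝 (X s)) := by
  have hC0 : 0 ≤ C := (norm_nonneg _).trans (hC 0 x)
  have hm : ∀ m, Measurable fun r => picard b a x m r := fun m =>
    (measurable_picard (b := fun _ : Unit => b) (hb.comp measurable_snd) a x m).comp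
      (measurable_const.prodMk measurable_id : Measurable fun r : ℝ => ((), r))
  set M : ℝ := 2 * C * Real.exp ((2 * K + 1) * (c - a)) with hM
  have hM0 : 0 ≤ M := by positivity
  have hstep : ∀ s ∈ Icc a c, ∀ m,
      dist (picard b a x m s) (picard b a x (m + 1) s) ≤ M / 2 / 2 ^ m := by
    intro s hs m
    rw [dist_comm, dist_eq_norm]
    refine (norm_picard_succ_sub_le hb hC hK m hs.1).trans ?_
    have : Real.exp ((2 * K + 1) * (s - a)) ≤ Real.exp ((2 * K + 1) * (c - a)) :=
      Real.exp_le_exp.2 (mul_le_mul_of_nonneg_left (by linarith [hs.2]) (by positivity))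
    calc _ ≤ C / 2 ^ m * Real.exp ((2 * K + 1) * (c - a)) :=
          mul_le_mul_of_nonneg_left this (by positivity)
      _ = _ := by rw [hM]; ring
  choose! X hX using fun s (hs : s ∈ Icc a c) =>
    cauchySeq_tendsto_of_complete (cauchySeq_of_le_geometric_two (hstep s hs))
  have hdist : ∀ s ∈ Icc a c, ∀ m, dist (picard b a x m s) (X s) ≤ M / 2 ^ m := fun s hs m =>
    dist_le_of_le_geometric_two_of_tendsto (hstep s hs) (hX s hs) m
  have hXm : AEMeasurable X (volume.restrict (Icc a c)) :=
    aemeasurable_of_tendsto_metrizable_ae atTop (fun m => (hm m).aemeasurable)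
      ((ae_restrict_iff' measurableSet_Icc).2 (Eventually.of_forall hX))
  have hXm' : ∀ s ∈ Icc a c, AEMeasurable X (volume.restrict (Ioc a s)) := fun s hs =>
    hXm.mono_measure (Measure.restrict_mono
      (Ioc_subset_Icc_self.trans (Icc_subset_Icc_right hs.2)) le_rfl)
  have heq : ∀ s ∈ Icc a c, X s = x + ∫ r in a..s, b r (X r) := by
    intro s hs
    refine tendsto_nhds_unique ((tendsto_add_atTop_iff_nat 1).2 (hX s hs)) ?_
    have hg : Tendsto (fun m : ℕ => (K : ℝ) * (M / 2 ^ m) * (s - a)) atTop (𝓝 0) := by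
      have h0 : Tendsto (fun m : ℕ => M * ((1 : ℝ) / 2) ^ m) atTop (𝓝 (M * 0)) :=
        (tendsto_pow_atTop_nhds_zero_of_lt_one (by norm_num) (by norm_num)).const_mul M
      have h1 := (h0.const_mul (K : ℝ)).mul_const (s - a)
      simp only [mul_zero, zero_mul] at h1
      refine h1.congr fun m => ?_
      rw [one_div, inv_pow, div_eq_mul_inv]
    refine tendsto_iff_dist_tendsto_zero.2 (squeeze_zero (fun _ => dist_nonneg) (fun m => ?_) hg)
    have hi1 := intervalIntegrable_of_bdd hb hC hs.1 (hm m).aemeasurable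
    have hi2 := intervalIntegrable_of_bdd hb hC hs.1 (hXm' s hs)
    have e : picard b a x (m + 1) s - (x + ∫ r in a..s, b r (X r)) =
        ∫ r in a..s, (b r (picard b a x m r) - b r (X r)) := by
      rw [intervalIntegral.integral_sub hi1 hi2, intervalIntegral.integral_of_le hs.1,
        intervalIntegral.integral_of_le hs.1]
      simp [picard]
    rw [dist_eq_norm, e]
    have h1 := intervalIntegral.norm_integral_le_of_norm_le_const (a := a) (b := s)
      (f := fun r => b r (picard b a x m r) - b r (X r)) (C := K * (M / 2 ^ m)) (fun r hr => by
        rw [uIoc_of_le hs.1] at hr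
        rw [← dist_eq_norm]
        exact ((hK r).dist_le_mul _ _).trans
          (mul_le_mul_of_nonneg_left (hdist r ⟨hr.1.le, hr.2.trans hs.2⟩ m) K.2))
    rwa [abs_of_nonneg (sub_nonneg.2 hs.1)] at h1
  refine ⟨X, ⟨?_, heq⟩, hX⟩
  rcases lt_or_ge c a with hca | hac
  · rw [Icc_eq_empty hca.not_ge]; exact continuousOn_empty _
  have hi := intervalIntegrable_of_bdd hb hC hac (hXm' c ⟨hac, le_rfl⟩)
  have h1 := intervalIntegral.continuousOn_primitive_interval' hi left_mem_uIcc
  rw [uIcc_of_le hac] at h1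
  exact (continuousOn_const.add h1).congr heq

theorem IsIntSol.norm_sub_init_le {a c : ℝ} {x : E} {X : ℝ → E} (hC : ∀ r y, ‖b r y‖ ≤ C)
    (hX : IsIntSol b a c x X) {s : ℝ} (hs : s ∈ Icc a c) : ‖X s - x‖ ≤ C * (s - a) := by
  rw [hX.2 s hs, add_sub_cancel_left]
  have := intervalIntegral.norm_integral_le_of_norm_le_const
    (f := fun r => b r (X r)) (a := a) (b := s) (C := C) (fun r _ => hC _ _)
  rwa [abs_of_nonneg (sub_nonneg.2 hs.1)] at this

theorem IsIntSol.mono {a c c' : ℝ} {x : E} {X : ℝ → E} (hX : IsIntSol b a c x X) (h : c' ≤ c) :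
    IsIntSol b a c' x X :=
  ⟨hX.1.mono (Icc_subset_Icc_right h), fun s hs => hX.2 s ⟨hs.1, hs.2.trans h⟩⟩

theorem IsIntSol.tail {a a' c : ℝ} {x : E} {X : ℝ → E}
    (hb : Measurable fun q : ℝ × E => b q.1 q.2) (hC : ∀ r y, ‖b r y‖ ≤ C)
    (hX : IsIntSol b a c x X) (h : a ≤ a') (h' : a' ≤ c) : IsIntSol b a' c (X a') X := by
  refine ⟨hX.1.mono (Icc_subset_Icc_left h), fun s hs => ?_⟩
  have hi : ∀ s ∈ Icc a c, IntervalIntegrable (fun r => b r (X r)) volume a s := fun s hs =>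
    intervalIntegrable_of_bdd hb hC hs.1
      (aemeasurable_of_continuousOn_Icc (hX.1.mono (Icc_subset_Icc_right hs.2)))
  have hs' : s ∈ Icc a c := ⟨h.trans hs.1, hs.2⟩
  rw [hX.2 a' ⟨h, h'⟩, hX.2 s hs', add_assoc, ← intervalIntegral.integral_interval_sub_left
    (hi s hs') (hi a' ⟨h, h'⟩)]
  abel_nf

theorem IsIntSol.congr_ae {b' : ℝ → E → E} {a c : ℝ} {x : E} {X : ℝ → E}
    (hX : IsIntSol b a c x X) (h : ∀ᵐ r, r ∈ Icc a c → b r = b' r) : IsIntSol b' a c x X := by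
  refine ⟨hX.1, fun s hs => ?_⟩
  rw [hX.2 s hs]
  congr 1
  refine intervalIntegral.integral_congr_ae ?_
  filter_upwards [h] with r hr hrs
  rw [uIoc_of_le hs.1] at hrs
  rw [hr ⟨hrs.1.le, hrs.2.trans hs.2⟩]

end Ode

section Dynamics

set_option linter.unusedSectionVars false

variable {d : ℕ} {U V : Type} [MetricSpace U] [CompactSpace U] [MetricSpace V] [CompactSpace V]
  [MeasurableSpace U] [BorelSpace U] [MeasurableSpace V] [BorelSpace V]

/-- The dynamics is continuous, bounded by `C`, and `K`-Lipschitz in the state. -/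
structure Regular (f : ℝ → EuclideanSpace ℝ (Fin d) → U → V → EuclideanSpace ℝ (Fin d))
    (C : ℝ) (K : ℝ≥0) : Prop where
  cont : Continuous fun q : ℝ × EuclideanSpace ℝ (Fin d) × U × V => f q.1 q.2.1 q.2.2.1 q.2.2.2
  bdd : ∀ t x u v, ‖f t x u v‖ ≤ C
  lip : ∀ t u v, LipschitzWith K fun x => f t x u v

variable {f : ℝ → EuclideanSpace ℝ (Fin d) → U → V → EuclideanSpace ℝ (Fin d)} {C : ℝ} {K : ℝ≥0}
  {T t c s : ℝ} {x y : EuclideanSpace ℝ (Fin d)} {u u' : ℝ → U} {v v' : ℝ → V}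

namespace Regular

theorem nonneg (hf : Regular f C K) (u : U) (v : V) : 0 ≤ C :=
  (norm_nonneg _).trans (hf.bdd 0 0 u v)

theorem measurable_drift {Ω' : Type*} {m0 : MeasurableSpace Ω'} (hf : Regular f C K)
    {u : ℝ → Ω' → U} {v : ℝ → Ω' → V} (hu : Measurable (Function.uncurry u))
    (hv : Measurable (Function.uncurry v)) :
    Measurable fun p : Ω' × ℝ × EuclideanSpace ℝ (Fin d) =>
      f p.2.1 p.2.2 (u p.2.1 p.1) (v p.2.1 p.1) := by
  have h1 : Measurable fun p : Ω' × ℝ × EuclideanSpace ℝ (Fin d) => (p.2.1, p.1) := by fun_prop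
  exact hf.cont.measurable.comp
    ((measurable_fst.comp measurable_snd).prodMk ((measurable_snd.comp measurable_snd).prodMk
      ((hu.comp h1).prodMk (hv.comp h1))))

theorem measurable_drift' (hf : Regular f C K) (hu : Measurable u) (hv : Measurable v) :
    Measurable fun q : ℝ × EuclideanSpace ℝ (Fin d) => f q.1 q.2 (u q.1) (v q.1) :=
  (hf.measurable_drift (Ω' := Unit) (u := fun r _ => u r) (v := fun r _ => v r)
    (hu.comp measurable_fst) (hv.comp measurable_fst)).comp
    (measurable_const.prodMk measurable_id : Measurable fun q => ((), q))

theorem isIntSol_sol_and_tendsto (hf : Regular f C K) (hu : Measurable u) (hv : Measurable v) :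
    IsIntSol (fun r y => f r y (u r) (v r)) t T x (sol f T t x u v) ∧
      ∀ s ∈ Icc t T, Tendsto (fun m => picard (fun r y => f r y (u r) (v r)) t x m s) atTop
        (𝓝 (sol f T t x u v s)) := by
  obtain ⟨X, hX, hXt⟩ := exists_isIntSol_picard (b := fun r y => f r y (u r) (v r)) (K := K) t T x
    (hf.measurable_drift' hu hv) (fun r y => hf.bdd _ _ _ _) (fun r => hf.lip _ _ _)
  have hS : IsIntSol (fun r y => f r y (u r) (v r)) t T x (sol f T t x u v) :=
    Classical.epsilon_spec (p := IsSol f T t x u v) ⟨X, hX⟩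
  refine ⟨hS, fun s hs => ?_⟩
  have := IsIntSol.norm_sub_le (b := fun r y => f r y (u r) (v r)) (C := C) (K := K)
    (hf.measurable_drift' hu hv)
    (fun r y => hf.bdd _ _ _ _) (fun r => hf.lip _ _ _) hX hS hs
  rw [sub_self, norm_zero, zero_mul, norm_le_zero_iff, sub_eq_zero] at this
  exact this ▸ hXt s hs

theorem isIntSol_sol (hf : Regular f C K) (hu : Measurable u) (hv : Measurable v) :
    IsIntSol (fun r y => f r y (u r) (v r)) t T x (sol f T t x u v) :=
  (hf.isIntSol_sol_and_tendsto hu hv).1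

theorem sol_init (hf : Regular f C K) (hu : Measurable u) (hv : Measurable v) (h : t ≤ T) :
    sol f T t x u v t = x := by
  rw [(hf.isIntSol_sol hu hv).2 t ⟨le_rfl, h⟩, intervalIntegral.integral_same, add_zero]

theorem continuousOn_sol (hf : Regular f C K) (hu : Measurable u) (hv : Measurable v) :
    ContinuousOn (sol f T t x u v) (Icc t T) :=
  (hf.isIntSol_sol hu hv).1

theorem sol_eq (hf : Regular f C K) (hu : Measurable u) (hv : Measurable v) (hs : s ∈ Icc t T) :
    sol f T t x u v s = x + ∫ r in t..s, f r (sol f T t x u v r) (u r) (v r) :=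
  (hf.isIntSol_sol hu hv).2 s hs

theorem norm_sol_sub_le (hf : Regular f C K) (hu : Measurable u) (hv : Measurable v)
    (hs : s ∈ Icc t T) : ‖sol f T t x u v s - x‖ ≤ C * (s - t) :=
  (hf.isIntSol_sol hu hv).norm_sub_init_le (fun _ _ => hf.bdd _ _ _ _) hs

theorem norm_sol_sub_sol_le (hf : Regular f C K) (hu : Measurable u) (hv : Measurable v)
    (hs : s ∈ Icc t T) :
    ‖sol f T t x u v s - sol f T t y u v s‖ ≤ ‖x - y‖ * Real.exp (K * (s - t)) :=
  IsIntSol.norm_sub_le (b := fun r y => f r y (u r) (v r)) (C := C) (K := K)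
    (hf.measurable_drift' hu hv) (fun _ _ => hf.bdd _ _ _ _)
    (fun _ => hf.lip _ _ _) (hf.isIntSol_sol hu hv) (hf.isIntSol_sol hu hv) hs

theorem sol_unique (hf : Regular f C K) (hu : Measurable u) (hv : Measurable v)
    {X : ℝ → EuclideanSpace ℝ (Fin d)}
    (hX : IsIntSol (fun r y => f r y (u r) (v r)) t c x X) (hc : c ≤ T) (hs : s ∈ Icc t c) :
    X s = sol f T t x u v s := by
  have := IsIntSol.norm_sub_le (b := fun r y => f r y (u r) (v r)) (C := C) (K := K)
    (hf.measurable_drift' hu hv) (fun r y => hf.bdd _ _ _ _)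
    (fun r => hf.lip _ _ _) hX
    ((hf.isIntSol_sol (T := T) (x := x) hu hv).mono hc) hs
  rwa [sub_self, norm_zero, zero_mul, norm_le_zero_iff, sub_eq_zero] at this

theorem sol_congr_ae (hf : Regular f C K) (hu : Measurable u) (hv : Measurable v)
    (hu' : Measurable u') (hv' : Measurable v') (hc : c ≤ T)
    (huu' : ∀ᵐ r, r ∈ Icc t c → u r = u' r) (hvv' : ∀ᵐ r, r ∈ Icc t c → v r = v' r)
    (hs : s ∈ Icc t c) : sol f T t x u v s = sol f T t x u' v' s := by
  refine hf.sol_unique hu' hv' (c := c) ?_ hc hs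
  refine ((hf.isIntSol_sol (T := T) hu hv).mono hc).congr_ae ?_
  filter_upwards [huu', hvv'] with r h1 h2 hr
  rw [h1 hr, h2 hr]

theorem sol_flow (hf : Regular f C K) (hu : Measurable u) (hv : Measurable v)
    (hc : c ∈ Icc t T) (hs : s ∈ Icc c T) :
    sol f T t x u v s = sol f T c (sol f T t x u v c) u v s :=
  hf.sol_unique hu hv ((hf.isIntSol_sol hu hv).tail (hf.measurable_drift' hu hv)
    (fun _ _ => hf.bdd _ _ _ _) hc.1 hc.2) le_rfl hs

theorem measurable_sol {Ω' : Type*} {m0 : MeasurableSpace Ω'} (hf : Regular f C K)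
    {u : ℝ → Ω' → U} {v : ℝ → Ω' → V} (hu : Measurable (Function.uncurry u))
    (hv : Measurable (Function.uncurry v)) (hs : s ∈ Icc t T) :
    Measurable fun ω => sol f T t x (fun r => u r ω) (fun r => v r ω) s := by
  have hm := fun m => (measurable_picard (b := fun ω r y => f r y (u r ω) (v r ω))
    (hf.measurable_drift hu hv) t x m).comp
    (measurable_id.prodMk measurable_const : Measurable fun ω => (ω, s))
  refine measurable_of_tendsto_metrizable hm (tendsto_pi_nhds.2 fun ω => ?_)
  exact (hf.isIntSol_sol_and_tendsto (hu.comp measurable_prodMk_right)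
    (hv.comp measurable_prodMk_right)).2 s hs

end Regular
end Dynamics

section Partitions

namespace Partition

variable {T : ℝ} (π : Partition T)

theorem t_le {i j : ℕ} (hij : i ≤ j) (hj : j ≤ π.n) : π.t i ≤ π.t j := by
  induction j, hij using Nat.le_induction with
  | base => exact le_rfl
  | succ j hij ih => exact (ih (by omega)).trans (π.mono j (by omega)).le

theorem t_nonneg {j : ℕ} (hj : j ≤ π.n) : 0 ≤ π.t j :=
  π.map_zero ▸ π.t_le (Nat.zero_le j) hj

theorem t_le_last {j : ℕ} (hj : j ≤ π.n) : π.t j ≤ T :=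
  (π.t_le hj le_rfl).trans_eq π.map_last

theorem idx_lt (s : ℝ) : π.idx s < π.n := by
  have := Nat.findGreatest_le (P := fun i => π.t i ≤ s) (π.n - 1)
  have := π.npos
  unfold idx
  omega

theorem t_idx_le {s : ℝ} (hs : 0 ≤ s) : π.t (π.idx s) ≤ s :=
  Nat.findGreatest_spec (P := fun i => π.t i ≤ s) (Nat.zero_le _) (by simpa [π.map_zero] using hs)

theorem lt_t_idx_succ {s : ℝ} (hs : s < T) : s < π.t (π.idx s + 1) := by
  by_contra! h
  rcases (Nat.succ_le_of_lt (π.idx_lt s)).eq_or_lt with h1 | h1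
  · rw [Nat.succ_eq_add_one] at h1
    rw [h1, π.map_last] at h
    exact h.not_gt hs
  · have := Nat.le_findGreatest (P := fun i => π.t i ≤ s) (n := π.n - 1)
      (m := π.idx s + 1) (by omega) h
    unfold idx at this
    omega

theorem idx_eq {s : ℝ} {j : ℕ} (hj : j < π.n) (h1 : π.t j ≤ s) (h2 : s < π.t (j + 1)) :
    π.idx s = j := by
  have hs : 0 ≤ s := (π.t_nonneg hj.le).trans h1
  have hsT : s < T := h2.trans_le (π.t_le_last hj)
  have h3 := π.t_idx_le hs
  have h4 := π.lt_t_idx_succ hsT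
  have h5 := π.idx_lt s
  rcases lt_trichotomy (π.idx s) j with h | h | h
  · exact absurd (h4.trans_le (π.t_le h hj.le)) h1.not_gt
  · exact h
  · exact absurd (h2.trans_le (π.t_le h h5.le)) h3.not_gt

theorem sub_le_mesh {j : ℕ} (hj : j < π.n) : π.t (j + 1) - π.t j ≤ π.mesh :=
  Finset.le_sup' (fun i => π.t (i + 1) - π.t i) (Finset.mem_range.2 hj)

end Partition

end Partitions

section Filtration

theorem Fsig_le (j : ℕ) : Fsig j ≤ (inferInstance : MeasurableSpace Omega) :=
  Measurable.comap_le (by fun_prop)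

theorem measurable_coord_Fsig {i j : ℕ} (h : i < j) :
    Measurable[Fsig j] (fun ω : Omega => ω i) :=
  (measurable_pi_apply (⟨i, h⟩ : Fin j)).comp
    (comap_measurable fun (ω : Omega) (k : Fin j) => ω (k : ℕ))

theorem Fsig_mono {i j : ℕ} (h : i ≤ j) : Fsig i ≤ Fsig j := by
  refine Measurable.comap_le ?_
  refine @measurable_pi_lambda _ _ _ (Fsig j) _ _ fun k => ?_
  exact measurable_coord_Fsig (k.2.trans_le h)

theorem mem_of_Fsig {j : ℕ} {A : Set Omega} (hA : MeasurableSet[Fsig j] A) {ω ω' : Omega}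
    (h : ∀ i < j, ω i = ω' i) (hω : ω ∈ A) : ω' ∈ A := by
  obtain ⟨B, -, rfl⟩ := hA
  have : (fun i : Fin j => ω' i) = fun i : Fin j => ω i := funext fun i => (h i i.2).symm
  simpa [mem_preimage, this] using hω

theorem measurable_diag {Ω' β : Type*} {m : MeasurableSpace Ω'} [MeasurableSpace β]
    {N : Ω' → ℕ} (hN : Measurable N) {F : ℕ → Ω' → β} (hF : ∀ k, Measurable (F k)) :
    Measurable fun ω => F (N ω) ω := by
  have : Measurable fun p : ℕ × Ω' => F p.1 p.2 := measurable_from_prod_countable_right hF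
  exact this.comp (hN.prodMk measurable_id)

end Filtration

section Admissible

variable {α : Type*} [MeasurableSpace α] {T : ℝ} {π : Partition T} {pr : I × I → I}

/-- Admissible controls with jointly measurable pieces; `pr` selects the coordinate of `ζ_{j+1}`
available to the player. -/
def IsAdm (pr : I × I → I) (π : Partition T) (u : ℝ → Omega → α) : Prop :=
  Measurable (Function.uncurry u) ∧ ∀ j < π.n, ∃ (N : Omega → ℕ) (w : ℕ → ℝ → I → α),
    Measurable[Fsig j] N ∧ (∀ k, Measurable (Function.uncurry (w k))) ∧
    ∀ ω, ∀ s ∈ Ico (π.t j) (π.t (j + 1)), u s ω = w (N ω) s (pr (ω j))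

theorem isAdm_of_pieces [MeasurableSingletonClass α] {u : ℝ → Omega → α}
    (hu : Measurable (Function.uncurry u)) {sec : I → I × I} (hsec : Measurable sec)
    (hps : ∀ z, pr (sec z) = z)
    (h : ∀ j < π.n, ∃ (Γ : ℕ → Set Omega) (w : ℕ → ℝ → Omega → α),
      (∀ k, MeasurableSet[Fsig j] (Γ k)) ∧
      Pairwise (Function.onFun Disjoint Γ) ∧
      (⋃ k, Γ k) = univ ∧
      (∀ k s, Measurable[MeasurableSpace.comap (fun ω => pr (ω j)) inferInstance] (w k s)) ∧
      (∀ k, ∀ ω ∈ Γ k, ∀ s ∈ Ico (π.t j) (π.t (j + 1)), u s ω = w k s ω)) :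
    IsAdm pr π u := by
  classical
  refine ⟨hu, fun j hj => ?_⟩
  obtain ⟨Γ, w, hΓ, hd, hU, hw, huw⟩ := h j hj
  have hex : ∀ ω, ∃ k, ω ∈ Γ k := fun ω => mem_iUnion.1 (hU ▸ mem_univ ω)
  choose N hN using hex
  have hNk : ∀ ω k, ω ∈ Γ k → N ω = k := fun ω k hk => by
    by_contra hne
    exact Set.disjoint_left.1 (hd hne) (hN ω) hk
  let ω0 : ℕ → Omega := fun k => if h : (Γ k).Nonempty then h.some else fun _ => (0, 0)
  have hω0 : ∀ k ω, ω ∈ Γ k → ω0 k ∈ Γ k := fun k ω hω => by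
    have h : (Γ k).Nonempty := ⟨ω, hω⟩
    simp only [ω0, dif_pos h]
    exact h.some_mem
  refine ⟨N, fun k s z => u s (Function.update (ω0 k) j (sec z)), ?_, fun k => ?_, ?_⟩
  · refine @measurable_to_countable' _ _ _ _ (Fsig j) _ fun k => ?_
    have : N ⁻¹' {k} = Γ k := by
      ext ω
      exact ⟨fun h => by rw [mem_preimage, mem_singleton_iff] at h; exact h ▸ hN ω, hNk ω k⟩
    rw [this]
    exact hΓ k
  · have h1 : Measurable fun q : ℝ × I => (q.1, Function.update (ω0 k) j (sec q.2)) :=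
      measurable_fst.prodMk ((measurable_update (ω0 k)).comp (hsec.comp measurable_snd))
    exact hu.comp h1
  · intro ω s hs
    have hm := hN ω
    have hm' : Function.update (ω0 (N ω)) j (sec (pr (ω j))) ∈ Γ (N ω) :=
      mem_of_Fsig (hΓ _) (fun i hi => (Function.update_of_ne hi.ne _ _).symm) (hω0 _ ω hm)
    dsimp only
    rw [huw _ _ hm s hs, huw _ _ hm' s hs]
    obtain ⟨B, -, hB⟩ := hw (N ω) s (measurableSet_singleton (w (N ω) s ω))
    have h1 : ω ∈ w (N ω) s ⁻¹' {w (N ω) s ω} := rfl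
    have h2 : Function.update (ω0 (N ω)) j (sec (pr (ω j))) ∈ w (N ω) s ⁻¹' {w (N ω) s ω} := by
      rw [← hB] at h1 ⊢
      simpa [hps] using h1
    exact h2.symm

theorem IsAdm.pieces {u : ℝ → Omega → α} (h : IsAdm pr π u) :
    ∀ j < π.n, ∃ (Γ : ℕ → Set Omega) (w : ℕ → ℝ → Omega → α),
      (∀ k, MeasurableSet[Fsig j] (Γ k)) ∧
      Pairwise (Function.onFun Disjoint Γ) ∧
      (⋃ k, Γ k) = univ ∧
      (∀ k s, Measurable[MeasurableSpace.comap (fun ω => pr (ω j)) inferInstance] (w k s)) ∧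
      (∀ k, ∀ ω ∈ Γ k, ∀ s ∈ Ico (π.t j) (π.t (j + 1)), u s ω = w k s ω) := by
  intro j hj
  obtain ⟨N, w, hN, hw, huw⟩ := h.2 j hj
  refine ⟨fun k => N ⁻¹' {k}, fun k s ω => w k s (pr (ω j)),
    fun k => hN (measurableSet_singleton k),
    fun k l hkl => ?_, ?_, fun k s => ?_, ?_⟩
  · exact Disjoint.preimage N (disjoint_singleton.2 hkl)
  · ext ω; simp
  · exact ((hw k).comp measurable_prodMk_left : Measurable fun z => w k s z).comp
      (comap_measurable (fun ω : Omega => pr (ω j)))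
  · rintro k ω rfl s hs
    exact huw ω s hs

theorem mem_admControl1_iff {U : Type} [MeasurableSpace U] [MeasurableSingletonClass U]
    {u : ℝ → Omega → U} : u ∈ AdmControl1 U π ↔ IsAdm Prod.fst π u :=
  ⟨fun h => isAdm_of_pieces h.1 (sec := fun z => (z, 0)) (by fun_prop) (fun _ => rfl) h.2,
    fun h => ⟨h.1, h.pieces⟩⟩

theorem mem_admControl2_iff {U : Type} [MeasurableSpace U] [MeasurableSingletonClass U]
    {u : ℝ → Omega → U} : u ∈ AdmControl2 U π ↔ IsAdm Prod.snd π u :=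
  ⟨fun h => isAdm_of_pieces h.1 (sec := fun z => (0, z)) (by fun_prop) (fun _ => rfl) h.2,
    fun h => ⟨h.1, h.pieces⟩⟩

theorem isAdm_deterministic {u : ℝ → α} (hu : Measurable u) : IsAdm pr π fun s _ => u s :=
  ⟨hu.comp measurable_fst, fun _ _ => ⟨fun _ => 0, fun _ s _ => u s,
    @measurable_const _ _ _ (Fsig _) _,
    fun _ => hu.comp measurable_fst, fun _ _ _ => rfl⟩⟩

theorem isAdm_interval (hpr : Measurable pr) {j : ℕ} (hj : j < π.n) {u : ℝ → I → α}
    (hu : Measurable (Function.uncurry u)) (a : α) :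
    IsAdm pr π fun s ω => if s ∈ Ico (π.t j) (π.t (j + 1)) then u s (pr (ω j)) else a := by
  constructor
  · refine Measurable.ite (measurable_fst measurableSet_Ico) ?_ measurable_const
    exact hu.comp (measurable_fst.prodMk
      (hpr.comp ((measurable_pi_apply j).comp measurable_snd)))
  · intro i hi
    by_cases hij : i = j
    · subst hij
      refine ⟨fun _ => 0, fun _ => u, @measurable_const _ _ _ (Fsig _) _, fun _ => hu, ?_⟩
      intro ω s hs
      exact if_pos hs
    · refine ⟨fun _ => 0, fun _ _ _ => a, @measurable_const _ _ _ (Fsig _) _,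
        fun _ => measurable_const, ?_⟩
      intro ω s hs
      refine if_neg fun hs' => ?_
      rcases lt_or_gt_of_ne hij with h | h
      · exact absurd (hs.2.trans_le (π.t_le h hj.le)) hs'.1.not_gt
      · exact absurd (hs'.2.trans_le (π.t_le h hi.le)) hs.1.not_gt

theorem IsAdm.paste {l : ℕ} (hl : l ≤ π.n) {N : Omega → ℕ} (hN : Measurable[Fsig l] N)
    {u0 : ℝ → Omega → α} {u : ℕ → ℝ → Omega → α} (h0 : IsAdm pr π u0)
    (hu : ∀ m, IsAdm pr π (u m)) :
    IsAdm pr π fun s ω => if s < π.t l then u0 s ω else u (N ω) s ω := by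
  constructor
  · refine Measurable.ite (measurable_fst measurableSet_Iio) h0.1 ?_
    exact measurable_diag (N := fun p : ℝ × Omega => N p.2)
      ((hN.mono (Fsig_le l) le_rfl).comp measurable_snd) fun m => (hu m).1
  · intro i hi
    rcases lt_or_ge i l with h | h
    · obtain ⟨N', w, hN', hw, he⟩ := h0.2 i hi
      refine ⟨N', w, hN', hw, fun ω s hs => ?_⟩
      exact (if_pos (hs.2.trans_le (π.t_le h hl))).trans (he ω s hs)
    · choose N' w hN' hw he using fun m => (hu m).2 i hi
      refine ⟨fun ω => Nat.pair (N ω) (N' (N ω) ω), fun k => w k.unpair.1 k.unpair.2, ?_,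
        fun k => hw _ _, fun ω s hs => ?_⟩
      · have h1 : Measurable[Fsig i] fun ω => N' (N ω) ω :=
          measurable_diag (hN.mono (Fsig_mono h) le_rfl) hN'
        exact (measurable_from_prod_countable_right (f := fun p : ℕ × ℕ => Nat.pair p.1 p.2)
          fun _ => measurable_from_top).comp
          ((hN.mono (Fsig_mono h) le_rfl).prodMk h1)
      · dsimp only
        rw [if_neg ((π.t_le h hi.le).trans hs.1).not_gt, Nat.unpair_pair]
        exact he _ ω s hs

end Admissible

section EssInf

variable {Ω' : Type*} {m0 : MeasurableSpace Ω'}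

theorem IsEssInfFam.congr {ι : Sort*} {P : Measure Omega} {ξ ξ' : ι → Omega → ℝ} {S : Omega → ℝ}
    (h : IsEssInfFam P ξ S) (he : ∀ i, ξ i =ᵐ[P] ξ' i) : IsEssInfFam P ξ' S :=
  ⟨fun i => (h.1 i).trans (he i).le, fun W hW => h.2 W fun i => (hW i).trans (he i).symm.le⟩

theorem exists_isEssInfFam_of_bdd {ι : Type*} [Nonempty ι] {P : Measure Omega}
    [IsProbabilityMeasure P] {ξ : ι → Omega → ℝ} {M : ℝ} (hm : ∀ i, Measurable (ξ i))
    (hb : ∀ i ω, |ξ i ω| ≤ M) : ∃ S, IsEssInfFam P ξ S := by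
  let S : (ℕ → ι) → Omega → ℝ := fun a ω => ⨅ k, ξ (a k) ω
  have hbb : ∀ (a : ℕ → ι) ω, BddBelow (range fun k => ξ (a k) ω) := fun a ω =>
    ⟨-M, by rintro _ ⟨k, rfl⟩; exact (abs_le.1 (hb _ _)).1⟩
  have hSm : ∀ a, Measurable (S a) := fun a => Measurable.iInf fun k => hm _
  have hSb : ∀ a ω, |S a ω| ≤ M := fun a ω =>
    abs_le.2 ⟨le_ciInf fun k => (abs_le.1 (hb _ _)).1,
      (ciInf_le (hbb a ω) 0).trans (abs_le.1 (hb _ _)).2⟩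
  have hSi : ∀ a, Integrable (S a) P := fun a =>
    Integrable.of_bound (hSm a).aestronglyMeasurable M (Eventually.of_forall fun ω => hSb a ω)
  have hSle : ∀ a k ω, S a ω ≤ ξ (a k) ω := fun a k ω => ciInf_le (hbb a ω) k
  have hIb : BddBelow (range fun a => ∫ ω, S a ω ∂P) := by
    refine ⟨-M, ?_⟩
    rintro _ ⟨a, rfl⟩
    have : ∫ _ : Omega, -M ∂P ≤ ∫ ω, S a ω ∂P :=
      integral_mono (integrable_const _) (hSi a) fun ω => (abs_le.1 (hSb a ω)).1
    simpa using this
  set I0 := ⨅ a, ∫ ω, S a ω ∂P with hI0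
  have hex : ∀ n : ℕ, ∃ a, ∫ ω, S a ω ∂P < I0 + 1 / (n + 1) := fun n =>
    exists_lt_of_ciInf_lt (lt_add_of_pos_right _ (by positivity))
  choose a ha using hex
  let b : ℕ → ι := fun k => a k.unpair.1 k.unpair.2
  have hba : ∀ n ω, S b ω ≤ S (a n) ω := fun n ω => le_ciInf fun k => by
    have := hSle b (Nat.pair n k) ω
    simpa [b] using this
  have hb0 : ∫ ω, S b ω ∂P ≤ I0 := by
    refine le_of_forall_pos_lt_add fun ε hε => ?_
    obtain ⟨n, hn⟩ := exists_nat_one_div_lt hε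
    exact ((integral_mono (hSi b) (hSi _) (hba n)).trans_lt (ha n)).trans (by linarith)
  refine ⟨S b, fun i => ?_, fun W hW => ?_⟩
  · let b' : ℕ → ι := fun k => k.casesOn i b
    have h1 : ∀ ω, S b' ω ≤ S b ω := fun ω => le_ciInf fun k => hSle b' (k + 1) ω
    have h2 : ∫ ω, S b' ω ∂P = ∫ ω, S b ω ∂P :=
      le_antisymm (integral_mono (hSi _) (hSi _) h1) (hb0.trans (ciInf_le hIb b'))
    have h3 := (integral_eq_iff_of_ae_le (hSi b') (hSi b) (Eventually.of_forall h1)).1 h2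
    filter_upwards [h3] with ω hω
    rw [← hω]
    exact hSle b' 0 ω
  · filter_upwards [ae_all_iff.2 fun k => hW (b k)] with ω hω
    exact le_ciInf hω

theorem exists_isEssInfFam {ι : Type*} [Nonempty ι] {P : Measure Omega}
    [IsProbabilityMeasure P] {ξ : ι → Omega → ℝ} {M : ℝ} (hm : ∀ i, Measurable (ξ i))
    (hM : 0 ≤ M) (hb : ∀ i, ∀ᵐ ω ∂P, |ξ i ω| ≤ M) : ∃ S, IsEssInfFam P ξ S := by
  obtain ⟨S, hS⟩ := exists_isEssInfFam_of_bdd (P := P) (ξ := fun i ω => max (-M) (min M (ξ i ω)))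
    (M := M) (fun i => measurable_const.max (measurable_const.min (hm i)))
    (fun i ω => abs_le.2 ⟨le_max_left _ _, max_le (by linarith) (min_le_left _ _)⟩)
  refine ⟨S, hS.congr fun i => ?_⟩
  filter_upwards [hb i] with ω hω
  rw [min_eq_right (abs_le.1 hω).2, max_eq_right (abs_le.1 hω).1]

theorem ae_le_condExp_of_setIntegral {μ : Measure Ω'} [IsFiniteMeasure μ] {m : MeasurableSpace Ω'}
    (hm : m ≤ m0) {X : Ω' → ℝ} (hX : Integrable X μ) {a : ℝ}
    (h : ∀ A, MeasurableSet[m] A → a * μ.real A ≤ ∫ ω in A, X ω ∂μ) :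
    ∀ᵐ ω ∂μ, a ≤ (μ[X | m]) ω := by
  have key : ∀ n : ℕ, ∀ᵐ ω ∂μ, a - 1 / (n + 1) < (μ[X | m]) ω := fun n => by
    let A := {ω | (μ[X | m]) ω ≤ a - 1 / (n + 1)}
    have hA : MeasurableSet[m] A :=
      (stronglyMeasurable_condExp (μ := μ) (f := X)).measurable measurableSet_Iic
    have h1 := h A hA
    rw [← setIntegral_condExp hm hX hA] at h1
    have h2 : ∫ ω in A, (μ[X | m]) ω ∂μ ≤ ∫ ω in A, (a - 1 / (n + 1)) ∂μ :=
      setIntegral_mono_on integrable_condExp.integrableOn (integrable_const _).integrableOn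
        (hm _ hA) fun ω hω => hω
    rw [setIntegral_const, smul_eq_mul] at h2
    have h3 : 0 < (1 : ℝ) / (n + 1) := by positivity
    have h4 : μ.real A = 0 := by
      have := measureReal_nonneg (μ := μ) (s := A)
      nlinarith
    rw [measureReal_eq_zero_iff] at h4
    refine measure_mono_null (fun ω hω => ?_) h4
    exact not_lt.1 (show ¬ (a - 1 / ((n : ℝ) + 1) < (μ[X | m]) ω) from hω)
  filter_upwards [ae_all_iff.2 key] with ω hω
  refine le_of_forall_pos_sub_le fun ε hε => ?_
  obtain ⟨n, hn⟩ := exists_nat_one_div_lt hε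
  linarith [hω n]

theorem condExp_le_of_setIntegral {μ : Measure Ω'} [IsFiniteMeasure μ] {m : MeasurableSpace Ω'}
    (hm : m ≤ m0) {X : Ω' → ℝ} (hX : Integrable X μ) {a : ℝ}
    (h : ∀ A, MeasurableSet[m] A → ∫ ω in A, X ω ∂μ ≤ a * μ.real A) :
    ∀ᵐ ω ∂μ, (μ[X | m]) ω ≤ a := by
  have h1 := ae_le_condExp_of_setIntegral hm hX.neg (a := -a) fun A hA => by
    have := h A hA
    simp only [Pi.neg_apply, integral_neg]
    linarith
  filter_upwards [h1, condExp_neg X m (μ := μ)] with ω h1 h2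
  rw [h2, Pi.neg_apply] at h1
  linarith

end EssInf

section FixPair

set_option linter.unusedSectionVars false

variable {d : ℕ} {U V : Type} [MetricSpace U] [CompactSpace U] [MetricSpace V] [CompactSpace V]
  [MeasurableSpace U] [BorelSpace U] [MeasurableSpace V] [BorelSpace V]
  {T t : ℝ} {P : Measure Omega} {π : Partition T}

theorem isStoppingIdx_const {j : ℕ} (hj : j < π.n) : IsStoppingIdx π fun _ => j :=
  ⟨fun _ => hj, fun _ => @MeasurableSet.const _ (Fsig _) _⟩

theorem ae_slice [IsProbabilityMeasure P] {Q : ℝ → Omega → Prop}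
    (h : ∀ᵐ p ∂((volume : Measure ℝ).prod P), Q p.1 p.2) : ∀ᵐ ω ∂P, ∀ᵐ s, Q s ω :=
  Measure.ae_ae_of_ae_prod
    ((Measure.measurePreserving_swap (μ := P)
      (ν := (volume : Measure ℝ))).quasiMeasurePreserving.ae h)

theorem aeStEq.mono {α : Type*} {u u' : ℝ → Omega → α} {b b' : Omega → ℝ}
    (h : aeStEq P t b u u') (hb : ∀ ω, b' ω ≤ b ω) : aeStEq P t b' u u' := by
  filter_upwards [h] with p hp h1 h2
  exact hp h1 (h2.trans (hb _))

theorem aeStEq_self {α : Type*} (u : ℝ → Omega → α) (b : Omega → ℝ) : aeStEq P t b u u :=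
  Eventually.of_forall fun _ _ _ => rfl

theorem aeStEq_of_le {α : Type*} [SFinite P] (u u' : ℝ → Omega → α) {b : ℝ} (hb : b ≤ t) :
    aeStEq P t (fun _ => b) u u' := by
  have h : ∀ᵐ p ∂((volume : Measure ℝ).prod P), p.1 ≠ t :=
    Measure.quasiMeasurePreserving_fst.ae (compl_mem_ae_iff.2 (by simp : volume {t} = 0))
  filter_upwards [h] with p hp h1 h2
  exact absurd (le_antisymm (h2.trans hb) h1) hp

theorem exists_isFixPair [Nonempty U] [SFinite P] (ht : 0 ≤ t)
    {α : (ℝ → Omega → V) → (ℝ → Omega → U)} {β : (ℝ → Omega → U) → (ℝ → Omega → V)}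
    (hα : IsNAD1 U V P π t α) (hβ : IsNAD2 U V P π t β) :
    ∃ p : (ℝ → Omega → U) × (ℝ → Omega → V), IsFixPair P π t T α β p.1 p.2 := by
  let u : ℕ → ℝ → Omega → U := fun m => (fun u => α (β u))^[m] fun _ _ => Classical.arbitrary U
  have hs : ∀ m, u (m + 1) = α (β (u m)) := fun m => Function.iterate_succ_apply' _ _ _
  have hu : ∀ m, u m ∈ AdmControl1 U π := fun m => by
    induction m with
    | zero => exact mem_admControl1_iff.2 (isAdm_deterministic measurable_const)
    | succ m ih => rw [hs]; exact hα.1 _ (hβ.1 _ ih)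
  have key : ∀ m ≤ π.n, aeStEq P t (fun _ => π.t m) (u m) (u (m + 1)) := by
    intro m hm
    induction m with
    | zero => exact aeStEq_of_le _ _ (by rwa [π.map_zero])
    | succ m ih =>
      have h1 := hβ.2 _ (isStoppingIdx_const (by omega : m < π.n)) _ _ (hu m) (hu (m + 1))
        (ih (by omega))
      rw [hs, hs (m + 1)]
      exact hα.2 _ (isStoppingIdx_const (by omega : m < π.n)) _ _ (hβ.1 _ (hu m))
        (hβ.1 _ (hu (m + 1))) (h1.mono fun _ => (π.mono m (by omega)).le)
  refine ⟨(u π.n, β (u π.n)), hu _, hβ.1 _ (hu _), ?_, ?_⟩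
  · filter_upwards [key _ le_rfl] with p hp h
    have := hp h.1 (h.2.trans_eq π.map_last.symm)
    rw [hs] at this
    exact this.symm
  · exact Eventually.of_forall fun _ _ => rfl

/-- The terminal payoff of a pair of controls. -/
def run (f : ℝ → EuclideanSpace ℝ (Fin d) → U → V → EuclideanSpace ℝ (Fin d))
    (g : EuclideanSpace ℝ (Fin d) → ℝ) (T t : ℝ) (x : EuclideanSpace ℝ (Fin d))
    (u : ℝ → Omega → U) (v : ℝ → Omega → V) (ω : Omega) : ℝ :=
  g (sol f T t x (fun r => u r ω) (fun r => v r ω) T)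

variable {f : ℝ → EuclideanSpace ℝ (Fin d) → U → V → EuclideanSpace ℝ (Fin d)} {C : ℝ} {K : ℝ≥0}
  {g : EuclideanSpace ℝ (Fin d) → ℝ} {x : EuclideanSpace ℝ (Fin d)}

theorem measurable_slice {α : Type*} [MeasurableSpace α] {u : ℝ → Omega → α}
    (hu : Measurable (Function.uncurry u)) (ω : Omega) : Measurable fun r => u r ω :=
  hu.comp measurable_prodMk_right

theorem measurable_run (hf : Regular f C K) (hg : Continuous g) (ht : t ≤ T)
    {u : ℝ → Omega → U} {v : ℝ → Omega → V} (hu : Measurable (Function.uncurry u))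
    (hv : Measurable (Function.uncurry v)) : Measurable (run f g T t x u v) :=
  hg.measurable.comp (hf.measurable_sol hu hv ⟨ht, le_rfl⟩)

theorem integrable_run [IsProbabilityMeasure P] (hf : Regular f C K) (hg : Continuous g) {M : ℝ}
    (hM : ∀ x, |g x| ≤ M) (ht : t ≤ T)
    {u : ℝ → Omega → U} {v : ℝ → Omega → V} (hu : Measurable (Function.uncurry u))
    (hv : Measurable (Function.uncurry v)) : Integrable (run f g T t x u v) P :=
  Integrable.of_bound (measurable_run hf hg ht hu hv).aestronglyMeasurable M
    (Eventually.of_forall fun _ => hM _)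

theorem run_congr [IsProbabilityMeasure P] (hf : Regular f C K) (ht : t ≤ T)
    {u u' : ℝ → Omega → U} {v v' : ℝ → Omega → V}
    (hu : Measurable (Function.uncurry u)) (hv : Measurable (Function.uncurry v))
    (hu' : Measurable (Function.uncurry u')) (hv' : Measurable (Function.uncurry v'))
    (huu' : aeEqIcc P t T u u') (hvv' : aeEqIcc P t T v v') :
    run f g T t x u v =ᵐ[P] run f g T t x u' v' := by
  filter_upwards [ae_slice (Q := fun s ω => s ∈ Icc t T → u s ω = u' s ω) huu',
    ae_slice (Q := fun s ω => s ∈ Icc t T → v s ω = v' s ω) hvv'] with ω h1 h2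
  unfold run
  rw [hf.sol_congr_ae (measurable_slice hu ω) (measurable_slice hv ω) (measurable_slice hu' ω)
    (measurable_slice hv' ω) le_rfl h1 h2 ⟨ht, le_rfl⟩]

theorem payoff_ae_eq [Nonempty U] [Nonempty V] [IsProbabilityMeasure P] (hf : Regular f C K)
    (ht : t ∈ Icc 0 T)
    {α : (ℝ → Omega → V) → (ℝ → Omega → U)} {β : (ℝ → Omega → U) → (ℝ → Omega → V)}
    (hα : IsNAD1 U V P π t α) (hβ : IsNAD2 U V P π t β) :
    (fixPair P π t T α β).2 ∈ AdmControl2 V π ∧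
    aeEqIcc P t T (β (fixPair P π t T α β).1) (fixPair P π t T α β).2 ∧
    payoff f g P π t x α β =ᵐ[P]
      run f g T t x (α (fixPair P π t T α β).2) (fixPair P π t T α β).2 := by
  have h : IsFixPair P π t T α β (fixPair P π t T α β).1 (fixPair P π t T α β).2 :=
    Classical.epsilon_spec (p := fun p : (ℝ → Omega → U) × (ℝ → Omega → V) =>
      IsFixPair P π t T α β p.1 p.2) (exists_isFixPair ht.1 hα hβ)
  obtain ⟨h1, h2, h3, h4⟩ := h
  refine ⟨h2, h4, ?_⟩
  exact (run_congr hf ht.2 (hα.1 _ h2).1 h2.1 h1.1 h2.1 h3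
    (Eventually.of_forall fun _ _ => rfl)).symm

theorem isNAD2_const {v : ℝ → Omega → V} (hv : v ∈ AdmControl2 V π) :
    IsNAD2 U V P π t fun _ => v :=
  ⟨fun _ _ => hv, fun _ _ _ _ _ _ _ => aeStEq_self _ _⟩

theorem isNAD1_const {u : ℝ → Omega → U} (hu : u ∈ AdmControl1 U π) :
    IsNAD1 U V P π t fun _ => u :=
  ⟨fun _ _ => hu, fun _ _ _ _ _ _ _ => aeStEq_self _ _⟩

theorem payoff_const_ae_eq [Nonempty U] [Nonempty V] [IsProbabilityMeasure P] (hf : Regular f C K)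
    (ht : t ∈ Icc 0 T)
    {α : (ℝ → Omega → V) → (ℝ → Omega → U)} (hα : IsNAD1 U V P π t α)
    {v : ℝ → Omega → V} (hv : v ∈ AdmControl2 V π) :
    payoff f g P π t x α (fun _ => v) =ᵐ[P] run f g T t x (α v) v := by
  obtain ⟨h1, h2, h3⟩ := payoff_ae_eq (g := g) (x := x) hf ht hα (isNAD2_const hv)
  refine h3.trans (run_congr hf ht.2 (hα.1 _ h1).1 h1.1 (hα.1 _ hv).1 hv.1 ?_ ?_)
  · have hn : π.n - 1 + 1 = π.n := Nat.sub_add_cancel π.npos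
    have h4 := hα.2 _ (isStoppingIdx_const (by omega : π.n - 1 < π.n)) _ _ h1 hv (by
      filter_upwards [h2] with p hp h5 h6
      exact (hp ⟨h5, h6.trans (π.t_le_last (Nat.sub_le _ _))⟩).symm)
    filter_upwards [h4] with p hp h5
    exact hp h5.1 (by rw [hn, π.map_last]; exact h5.2)
  · filter_upwards [h2] with p hp h5
    exact (hp h5).symm

end FixPair

section Bounds

set_option linter.unusedSectionVars false

variable {d : ℕ} {U V : Type} [MetricSpace U] [CompactSpace U] [MetricSpace V] [CompactSpace V]
  [MeasurableSpace U] [BorelSpace U] [MeasurableSpace V] [BorelSpace V]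
  {T t : ℝ}

/-- Player 1 has a strategy that secures at least `c` conditionally on `𝓕_j`. -/
def LowerB (f : ℝ → EuclideanSpace ℝ (Fin d) → U → V → EuclideanSpace ℝ (Fin d))
    (g : EuclideanSpace ℝ (Fin d) → ℝ) (P : Measure Omega) (π : Partition T) (t : ℝ) (j : ℕ)
    (x : EuclideanSpace ℝ (Fin d)) (c : ℝ) : Prop :=
  ∃ α : (ℝ → Omega → V) → (ℝ → Omega → U), IsNAD1 U V P π t α ∧ ∀ v ∈ AdmControl2 V π,
    ∀ A, MeasurableSet[Fsig j] A → c * P.real A ≤ ∫ ω in A, run f g T t x (α v) v ω ∂P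

/-- Player 2 can answer every strategy so that the payoff is at most `c` conditionally on `𝓕_j`. -/
def UpperB (f : ℝ → EuclideanSpace ℝ (Fin d) → U → V → EuclideanSpace ℝ (Fin d))
    (g : EuclideanSpace ℝ (Fin d) → ℝ) (P : Measure Omega) (π : Partition T) (t : ℝ) (j : ℕ)
    (x : EuclideanSpace ℝ (Fin d)) (c : ℝ) : Prop :=
  ∀ α : (ℝ → Omega → V) → (ℝ → Omega → U), IsNAD1 U V P π t α → ∃ v ∈ AdmControl2 V π,
    ∀ A, MeasurableSet[Fsig j] A → ∫ ω in A, run f g T t x (α v) v ω ∂P ≤ c * P.real A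

variable {P : Measure Omega} {π : Partition T}
  {f : ℝ → EuclideanSpace ℝ (Fin d) → U → V → EuclideanSpace ℝ (Fin d)} {C : ℝ} {K : ℝ≥0}
  {g : EuclideanSpace ℝ (Fin d) → ℝ} {x : EuclideanSpace ℝ (Fin d)} {M c : ℝ}

theorem ae_le_of_forall_pos {X Y : Omega → ℝ}
    (h : ∀ ε : ℝ, 0 < ε → ∀ᵐ ω ∂P, X ω ≤ Y ω + ε) : X ≤ᵐ[P] Y := by
  filter_upwards [ae_all_iff.2 fun n : ℕ => h (1 / (n + 1)) (by positivity)] with ω hω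
  refine le_of_forall_pos_le_add fun ε hε => ?_
  obtain ⟨n, hn⟩ := exists_nat_one_div_lt hε
  linarith [hω n]

theorem lowerValD_eq [Nonempty U] [Nonempty V] [IsProbabilityMeasure P] (hf : Regular f C K)
    (hg : Continuous g) (hM : ∀ x, |g x| ≤ M) (ht : t ∈ Icc 0 T)
    (hL : ∀ ε : ℝ, 0 < ε → LowerB f g P π t (π.idx t) x (c - ε))
    (hU : ∀ ε : ℝ, 0 < ε → UpperB f g P π t (π.idx t) x (c + ε)) :
    lowerValD U V f g P π t x = c := by
  let ξ : (α : {α // IsNAD1 U V P π t α}) → {β // IsNAD2 U V P π t β} → Omega → ℝ := fun α β =>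
    P[payoff f g P π t x α.1 β.1 | Fsig (π.idx t)]
  have hle := Fsig_le (π.idx t)
  have hJc : ∀ (α : {α // IsNAD1 U V P π t α}) J, IsEssInfFam P (ξ α) J → J ≤ᵐ[P] fun _ => c := by
    intro α J hJ
    refine ae_le_of_forall_pos fun ε hε => ?_
    obtain ⟨v, hv, hvA⟩ := hU ε hε α.1 α.2
    have h1 := hJ.1 ⟨fun _ => v, isNAD2_const hv⟩
    have h2 := condExp_congr_ae (m := Fsig (π.idx t))
      (payoff_const_ae_eq (g := g) (x := x) hf ht α.2 hv)
    have h3 := condExp_le_of_setIntegral hle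
      (integrable_run (x := x) hf hg hM ht.2 (α.2.1 v hv).1 hv.1) hvA
    filter_upwards [h1, h2, h3] with ω h1 h2 h3
    exact h1.trans (h2.le.trans h3)
  have hcJ : ∀ ε : ℝ, 0 < ε → ∃ α : {α // IsNAD1 U V P π t α}, ∀ J, IsEssInfFam P (ξ α) J →
      (fun _ => c - ε) ≤ᵐ[P] J := by
    intro ε hε
    obtain ⟨α, hα, hαv⟩ := hL ε hε
    refine ⟨⟨α, hα⟩, fun J hJ => hJ.2 _ fun β => ?_⟩
    obtain ⟨h1, -, h2⟩ := payoff_ae_eq (g := g) (x := x) hf ht hα β.2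
    have h3 := ae_le_condExp_of_setIntegral hle
      (integrable_run (x := x) hf hg hM ht.2 (hα.1 _ h1).1 h1.1) (hαv _ h1)
    filter_upwards [condExp_congr_ae (m := Fsig (π.idx t)) h2, h3] with ω h2 h3
    exact h3.trans h2.ge
  have hex : ∃ S, IsLowerVal U V f g P π t x S := by
    have hne : Nonempty {β // IsNAD2 U V P π t β} :=
      ⟨⟨_, isNAD2_const (v := fun _ _ => Classical.arbitrary V)
        (mem_admControl2_iff.2 (isAdm_deterministic measurable_const))⟩⟩
    have hJ : ∀ α : {α // IsNAD1 U V P π t α}, ∃ J, IsEssInfFam P (ξ α) J := fun α =>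
      exists_isEssInfFam (M := M) (fun β => (stronglyMeasurable_condExp.mono hle).measurable)
        ((abs_nonneg _).trans (hM 0)) fun β => by
          have := ae_bdd_abs_condExp_of_ae_bdd_abs (R := M)
            (m := Fsig (π.idx t)) (μ := P) (f := payoff f g P π t x α.1 β.1)
            (Eventually.of_forall fun ω => hM _)
          exact this
    choose J hJ using hJ
    refine ⟨fun _ => c, J, hJ, fun α => hJc α _ (hJ α), fun Z hZ => ?_⟩
    refine ae_le_of_forall_pos fun ε hε => ?_
    obtain ⟨α, hα⟩ := hcJ ε hε
    filter_upwards [hα _ (hJ α), hZ α] with ω h1 h2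
    linarith
  obtain ⟨J, hJ, hS⟩ : IsLowerVal U V f g P π t x (lowerVal U V f g P π t x) :=
    Classical.epsilon_spec hex
  have h1 : lowerVal U V f g P π t x ≤ᵐ[P] fun _ => c := hS.2 _ fun α => hJc α _ (hJ α)
  have h2 : (fun _ => c) ≤ᵐ[P] lowerVal U V f g P π t x := by
    refine ae_le_of_forall_pos fun ε hε => ?_
    obtain ⟨α, hα⟩ := hcJ ε hε
    filter_upwards [hα _ (hJ α), hS.1 α] with ω h1 h2
    linarith
  have h3 : lowerVal U V f g P π t x =ᵐ[P] fun _ => c := h1.antisymm h2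
  rw [lowerValD, integral_congr_ae h3, integral_const, probReal_univ, one_smul]

end Bounds

section Independence

variable {P : Measure Omega} {j : ℕ} {A : Set Omega}

theorem map_coord_past [IsProbabilityMeasure P] (hP : IsProductMeasure P) (j : ℕ) :
    P.map (fun ω : Omega => (ω j, fun i : Fin j => ω i)) =
      (volume : Measure (I × I)).prod (Measure.pi fun _ : Fin j => (volume : Measure (I × I))) := by
  have h1 := (measurePreserving_piFinSuccAbove
    (fun _ : Fin (j + 1) => (volume : Measure (I × I))) (Fin.last j)).map_eq
  rw [← hP (j + 1), Measure.map_map (MeasurableEquiv.measurable _) (by fun_prop)] at h1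
  refine Eq.trans ?_ h1
  congr 1
  funext ω
  refine Prod.ext ?_ (funext fun i => ?_)
  · simp [MeasurableEquiv.piFinSuccAbove, Fin.insertNthEquiv]
  · simp [MeasurableEquiv.piFinSuccAbove, Fin.insertNthEquiv, Fin.init]

theorem setIntegral_coord [IsProbabilityMeasure P] (hP : IsProductMeasure P)
    (hA : MeasurableSet[Fsig j] A) {ψ : I × I → ℝ} (hψ : Measurable ψ) :
    ∫ ω in A, ψ (ω j) ∂P = P.real A * ∫ z, ψ z := by
  obtain ⟨B, hB, rfl⟩ := hA
  have hm : Measurable (fun ω : Omega => (ω j, fun i : Fin j => ω i)) := by fun_prop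
  have h1 : ∀ φ : I × I → ℝ, Measurable φ →
      ∫ ω in (fun ω (i : Fin j) => ω (i : ℕ)) ⁻¹' B, φ (ω j) ∂P =
        (∫ z, φ z) * (Measure.pi fun _ : Fin j => (volume : Measure (I × I))).real B := by
    intro φ hφ
    have h2 := setIntegral_map (μ := P) (g := fun ω : Omega => (ω j, fun i : Fin j => ω i))
      (f := fun q : (I × I) × (Fin j → I × I) => φ q.1) (s := univ ×ˢ B)
      (MeasurableSet.univ.prod hB) (hφ.comp measurable_fst).aestronglyMeasurable
      hm.aemeasurable
    have h3 : (fun ω (i : Fin j) => ω (i : ℕ)) ⁻¹' B =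
        (fun ω : Omega => (ω j, fun i : Fin j => ω i)) ⁻¹' (univ ×ˢ B) := by
      ext ω; simp
    rw [h3, ← h2, map_coord_past hP]
    have h4 := setIntegral_prod_mul (μ := (volume : Measure (I × I)))
      (ν := Measure.pi fun _ : Fin j => (volume : Measure (I × I))) φ (fun _ => (1 : ℝ)) univ B
    simpa using h4
  have h2 := h1 (fun _ => 1) measurable_const
  rw [h1 ψ hψ, mul_comm]
  congr 1
  simpa using h2.symm

theorem setIntegral_le_of_cells {Ω' : Type*} {m0 : MeasurableSpace Ω'} {μ : Measure Ω'}
    {A : Set Ω'} (hA : MeasurableSet A)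
    {N : Ω' → ℕ} (hN : Measurable N) {F G : Ω' → ℝ} (hF : Integrable F μ) (hG : Integrable G μ)
    (h : ∀ k, ∫ ω in A ∩ N ⁻¹' {k}, F ω ∂μ ≤ ∫ ω in A ∩ N ⁻¹' {k}, G ω ∂μ) :
    ∫ ω in A, F ω ∂μ ≤ ∫ ω in A, G ω ∂μ := by
  have hU : (⋃ k, A ∩ N ⁻¹' {k}) = A := by
    ext ω; simp
  have hm : ∀ k, MeasurableSet (A ∩ N ⁻¹' {k}) := fun k => hA.inter (hN (measurableSet_singleton k))
  have hd : Pairwise (Function.onFun Disjoint fun k => A ∩ N ⁻¹' {k}) := fun k l hkl =>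
    (Disjoint.preimage N (disjoint_singleton.2 hkl)).mono inter_subset_right inter_subset_right
  have h1 := hasSum_integral_iUnion hm hd hF.integrableOn
  have h2 := hasSum_integral_iUnion hm hd hG.integrableOn
  rw [hU] at h1 h2
  exact hasSum_le h h1 h2

theorem le_setIntegral_frozen [IsProbabilityMeasure P] (hP : IsProductMeasure P)
    (hA : MeasurableSet[Fsig j] A) {N : Omega → ℕ} (hN : Measurable[Fsig j] N)
    {ψ : ℕ → I × I → ℝ} {M a : ℝ} (hψ : ∀ k, Measurable (ψ k)) (hM : ∀ k z, |ψ k z| ≤ M)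
    (h : ∀ k, a ≤ ∫ z, ψ k z) : a * P.real A ≤ ∫ ω in A, ψ (N ω) (ω j) ∂P := by
  have hN' := hN.mono (Fsig_le j) le_rfl
  have hi : Integrable (fun ω => ψ (N ω) (ω j)) P :=
    Integrable.of_bound (measurable_diag (F := fun k ω => ψ k (ω j)) hN'
      fun k => (hψ k).comp (measurable_pi_apply j)).aestronglyMeasurable M
      (Eventually.of_forall fun _ => hM _ _)
  have := setIntegral_le_of_cells (μ := P) (Fsig_le j _ hA) hN' (integrable_const a) hi fun k => by
    have hk : MeasurableSet[Fsig j] (A ∩ N ⁻¹' {k}) :=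
      @MeasurableSet.inter _ (Fsig j) _ _ hA (hN (measurableSet_singleton k))
    have h1 : ∫ ω in A ∩ N ⁻¹' {k}, ψ (N ω) (ω j) ∂P = ∫ ω in A ∩ N ⁻¹' {k}, ψ k (ω j) ∂P :=
      setIntegral_congr_fun (Fsig_le j _ hk) fun ω hω => by
        have : N ω = k := hω.2
        simp only [this]
    rw [h1, setIntegral_coord hP hk (hψ k), setIntegral_const, smul_eq_mul]
    exact mul_le_mul_of_nonneg_left (h k) measureReal_nonneg
  rw [setIntegral_const, smul_eq_mul] at this
  rwa [mul_comm]

theorem setIntegral_frozen_le [IsProbabilityMeasure P] (hP : IsProductMeasure P)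
    (hA : MeasurableSet[Fsig j] A) {N : Omega → ℕ} (hN : Measurable[Fsig j] N)
    {ψ : ℕ → I × I → ℝ} {M a : ℝ} (hψ : ∀ k, Measurable (ψ k)) (hM : ∀ k z, |ψ k z| ≤ M)
    (h : ∀ k, ∫ z, ψ k z ≤ a) : ∫ ω in A, ψ (N ω) (ω j) ∂P ≤ a * P.real A := by
  have := le_setIntegral_frozen hP hA hN (ψ := fun k z => -ψ k z) (M := M) (a := -a)
    (fun k => (hψ k).neg) (fun k z => by rw [abs_neg]; exact hM k z)
    (fun k => by rw [integral_neg]; exact neg_le_neg (h k))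
  rw [integral_neg] at this
  linarith

end Independence

section Step

set_option linter.unusedSectionVars false

variable {d : ℕ} {U V : Type} [MetricSpace U] [CompactSpace U] [MetricSpace V] [CompactSpace V]
  [MeasurableSpace U] [BorelSpace U] [MeasurableSpace V] [BorelSpace V]

/-- Expected value of `w` at time `c` when Player 1 plays the randomized control `u` and Player 2
plays the deterministic control `v` on `[t,c]`. -/
def cost (f : ℝ → EuclideanSpace ℝ (Fin d) → U → V → EuclideanSpace ℝ (Fin d)) (T t c : ℝ)
    (w : EuclideanSpace ℝ (Fin d) → ℝ) (x : EuclideanSpace ℝ (Fin d)) (u : ℝ → I → U)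
    (v : ℝ → V) : ℝ :=
  ∫ z : I, w (sol f T t x (fun r => u r z) v c)

/-- The value of the one-stage game on `[t,c]` with terminal payoff `w`. -/
def step (f : ℝ → EuclideanSpace ℝ (Fin d) → U → V → EuclideanSpace ℝ (Fin d)) (T t c : ℝ)
    (w : EuclideanSpace ℝ (Fin d) → ℝ) (x : EuclideanSpace ℝ (Fin d)) : ℝ :=
  ⨆ u : {u : ℝ → I → U // Measurable (Function.uncurry u)}, ⨅ v : {v : ℝ → V // Measurable v},
    cost f T t c w x u.1 v.1

variable {f : ℝ → EuclideanSpace ℝ (Fin d) → U → V → EuclideanSpace ℝ (Fin d)} {C : ℝ} {K : ℝ≥0}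
  {T t c M ε : ℝ} {w : EuclideanSpace ℝ (Fin d) → ℝ} {x y : EuclideanSpace ℝ (Fin d)}

theorem abs_integral_le_of_bdd {Ω' : Type*} {m0 : MeasurableSpace Ω'} {μ : Measure Ω'}
    [IsProbabilityMeasure μ] {F : Ω' → ℝ} (h : ∀ z, |F z| ≤ M) : |∫ z, F z ∂μ| ≤ M := by
  simpa using norm_integral_le_of_norm_le_const (μ := μ) (f := F) (Eventually.of_forall h)

theorem abs_cost_le (hw : ∀ y, |w y| ≤ M) (u : ℝ → I → U) (v : ℝ → V) :
    |cost f T t c w x u v| ≤ M :=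
  abs_integral_le_of_bdd fun _ => hw _

variable [Nonempty U] [Nonempty V]

instance : Nonempty {u : ℝ → I → U // Measurable (Function.uncurry u)} :=
  ⟨⟨fun _ _ => Classical.arbitrary U, measurable_const⟩⟩

instance : Nonempty {v : ℝ → V // Measurable v} :=
  ⟨⟨fun _ => Classical.arbitrary V, measurable_const⟩⟩

theorem exists_step_sub_le_cost (hw : ∀ y, |w y| ≤ M) (hε : 0 < ε) :
    ∃ u : ℝ → I → U, Measurable (Function.uncurry u) ∧ ∀ v : ℝ → V, Measurable v →
      step f T t c w x - ε ≤ cost f T t c w x u v := by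
  obtain ⟨u, hu⟩ := exists_lt_of_lt_ciSup (sub_lt_self (step f T t c w x) hε)
  refine ⟨u.1, u.2, fun v hv => hu.le.trans ?_⟩
  exact ciInf_le (f := fun v : {v : ℝ → V // Measurable v} => cost f T t c w x u.1 v.1)
    ⟨-M, by rintro _ ⟨v, rfl⟩; exact (abs_le.1 (abs_cost_le hw _ _)).1⟩ ⟨v, hv⟩

theorem exists_cost_le_step_add (hw : ∀ y, |w y| ≤ M) (hε : 0 < ε) {u : ℝ → I → U}
    (hu : Measurable (Function.uncurry u)) :
    ∃ v : ℝ → V, Measurable v ∧ cost f T t c w x u v ≤ step f T t c w x + ε := by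
  have h1 : ⨅ v : {v : ℝ → V // Measurable v}, cost f T t c w x u v.1 ≤ step f T t c w x := by
    refine le_ciSup (f := fun u : {u : ℝ → I → U // Measurable (Function.uncurry u)} =>
      ⨅ v : {v : ℝ → V // Measurable v}, cost f T t c w x u.1 v.1) ⟨M, ?_⟩ ⟨u, hu⟩
    rintro _ ⟨u, rfl⟩
    exact (ciInf_le ⟨-M, by rintro _ ⟨v, rfl⟩; exact (abs_le.1 (abs_cost_le hw _ _)).1⟩
      (Classical.arbitrary _)).trans (abs_le.1 (abs_cost_le hw _ _)).2
  obtain ⟨v, hv⟩ := exists_lt_of_ciInf_lt (h1.trans_lt (lt_add_of_pos_right _ hε))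
  exact ⟨v.1, v.2, hv.le⟩

theorem abs_step_le (hw : ∀ y, |w y| ≤ M) : |step f T t c w x| ≤ M := by
  rw [abs_le]
  constructor
  · refine le_of_forall_pos_le_add fun ε hε => ?_
    obtain ⟨v, hv, h⟩ := exists_cost_le_step_add (f := f) (T := T) (t := t) (c := c) (x := x)
      hw hε (u := fun _ _ => Classical.arbitrary U) measurable_const
    exact (abs_le.1 (abs_cost_le hw _ _)).1.trans h
  · refine le_of_forall_pos_le_add fun ε hε => ?_
    obtain ⟨u, hu, h⟩ := exists_step_sub_le_cost (f := f) (T := T) (t := t) (c := c) (x := x) hw hε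
    have h1 := h (fun _ => Classical.arbitrary V) measurable_const
    linarith [(abs_le.1 (abs_cost_le (f := f) (T := T) (t := t) (c := c) (x := x) hw u
      (fun _ => Classical.arbitrary V))).2]

theorem measurable_cost_integrand (hf : Regular f C K) (hw : Continuous w) (hc : c ∈ Icc t T)
    {u : ℝ → I → U} (hu : Measurable (Function.uncurry u)) {v : ℝ → V} (hv : Measurable v) :
    Measurable fun z : I => w (sol f T t x (fun r => u r z) v c) :=
  hw.measurable.comp (hf.measurable_sol (v := fun r _ => v r) hu (hv.comp measurable_fst) hc)

theorem integrable_cost_integrand (hf : Regular f C K) (hwc : Continuous w) (hw : ∀ y, |w y| ≤ M)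
    (hc : c ∈ Icc t T)
    {u : ℝ → I → U} (hu : Measurable (Function.uncurry u)) {v : ℝ → V} (hv : Measurable v) :
    Integrable fun z : I => w (sol f T t x (fun r => u r z) v c) :=
  Integrable.of_bound (measurable_cost_integrand hf hwc hc hu hv).aestronglyMeasurable M
    (Eventually.of_forall fun _ => hw _)

theorem cost_le_cost_add {L : ℝ≥0} (hf : Regular f C K) (hL : LipschitzWith L w)
    (hw : ∀ y, |w y| ≤ M) (hc : c ∈ Icc t T) {u : ℝ → I → U}
    (hu : Measurable (Function.uncurry u)) {v : ℝ → V} (hv : Measurable v) :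
    cost f T t c w x u v ≤
      cost f T t c w y u v + L * (Real.exp (K * (c - t)) * ‖x - y‖) := by
  have h1 : ∀ z : I, w (sol f T t x (fun r => u r z) v c) ≤
      w (sol f T t y (fun r => u r z) v c) + L * (Real.exp (K * (c - t)) * ‖x - y‖) := fun z => by
    have h2 := hL.dist_le_mul (sol f T t x (fun r => u r z) v c) (sol f T t y (fun r => u r z) v c)
    have h3 := hf.norm_sol_sub_sol_le (x := x) (y := y) (u := fun r => u r z)
      (hu.comp measurable_prodMk_right) hv hc
    rw [Real.dist_eq, dist_eq_norm] at h2
    have h4 := (le_abs_self _).trans (h2.trans (mul_le_mul_of_nonneg_left h3 L.2))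
    rw [mul_comm ‖x - y‖] at h4
    exact sub_le_iff_le_add'.1 h4
  have h5 := integral_mono (integrable_cost_integrand hf hL.continuous hw hc hu hv)
    ((integrable_cost_integrand hf hL.continuous hw hc hu hv).add
      (integrable_const (L * (Real.exp (K * (c - t)) * ‖x - y‖)))) h1
  refine h5.trans_eq ?_
  simp only [Pi.add_apply]
  rw [integral_add (integrable_cost_integrand hf hL.continuous hw hc hu hv) (integrable_const _)]
  simp [cost]

theorem lipschitzWith_step {L : ℝ≥0} (hf : Regular f C K) (hL : LipschitzWith L w)
    (hw : ∀ y, |w y| ≤ M) (hc : c ∈ Icc t T) :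
    LipschitzWith (L * (Real.exp (K * (c - t))).toNNReal) (step f T t c w) := by
  refine LipschitzWith.of_le_add_mul _ fun x y => ?_
  rw [NNReal.coe_mul, Real.coe_toNNReal _ (Real.exp_pos _).le, mul_assoc, dist_eq_norm]
  refine le_of_forall_pos_le_add fun ε hε => ?_
  obtain ⟨u, hu, h1⟩ := exists_step_sub_le_cost (f := f) (T := T) (t := t) (c := c) (x := x) hw
    (half_pos hε)
  obtain ⟨v, hv, h2⟩ := exists_cost_le_step_add (f := f) (T := T) (t := t) (c := c) (x := y) hw
    (half_pos hε) hu
  have h3 := h1 v hv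
  have h4 := cost_le_cost_add (x := x) (y := y) hf hL hw hc hu hv
  linarith

end Step

section Cells

theorem exists_measurable_cells {E : Type*} [MetricSpace E] [SecondCountableTopology E]
    [Nonempty E] [MeasurableSpace E] [BorelSpace E] {δ : ℝ} (hδ : 0 < δ) :
    ∃ (N : E → ℕ) (p : ℕ → E), Measurable N ∧ ∀ y, dist y (p (N y)) < δ := by
  classical
  have h : ∀ y : E, ∃ k, dist y (TopologicalSpace.denseSeq E k) < δ := fun y =>
    (TopologicalSpace.denseRange_denseSeq E).exists_dist_lt y hδ
  refine ⟨fun y => Nat.find (h y), TopologicalSpace.denseSeq E, measurable_find h fun k => ?_,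
    fun y => Nat.find_spec (h y)⟩
  exact measurableSet_lt (measurable_id.dist measurable_const) measurable_const

end Cells

section Stage

set_option linter.unusedSectionVars false

variable {d : ℕ} {U V : Type} [MetricSpace U] [CompactSpace U] [MetricSpace V] [CompactSpace V]
  [MeasurableSpace U] [BorelSpace U] [MeasurableSpace V] [BorelSpace V]
  {f : ℝ → EuclideanSpace ℝ (Fin d) → U → V → EuclideanSpace ℝ (Fin d)} {C : ℝ} {K : ℝ≥0}
  {T t c M ε : ℝ} {g w : EuclideanSpace ℝ (Fin d) → ℝ} {x y : EuclideanSpace ℝ (Fin d)}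
  {P : Measure Omega} {π : Partition T} {j : ℕ}

theorem ae_fst_ne [SFinite P] (c : ℝ) : ∀ᵐ p ∂((volume : Measure ℝ).prod P), p.1 ≠ c :=
  Measure.quasiMeasurePreserving_fst.ae (compl_mem_ae_iff.2 (by simp : volume {c} = 0))

theorem sol_congr_Ico (hf : Regular f C K) (hc : c ∈ Icc t T) {u u' : ℝ → U} {v v' : ℝ → V}
    (hu : Measurable u) (hv : Measurable v) (hu' : Measurable u') (hv' : Measurable v')
    (huu' : ∀ s ∈ Ico t c, u s = u' s) (hvv' : ∀ s ∈ Ico t c, v s = v' s) :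
    sol f T t x u v c = sol f T t x u' v' c := by
  have hne : ∀ᵐ r : ℝ, r ≠ c := compl_mem_ae_iff.2 (by simp : volume {c} = 0)
  refine hf.sol_congr_ae hu hv hu' hv' hc.2 ?_ ?_ ⟨hc.1, le_rfl⟩
  · filter_upwards [hne] with r hr h
    exact huu' r ⟨h.1, lt_of_le_of_ne h.2 hr⟩
  · filter_upwards [hne] with r hr h
    exact hvv' r ⟨h.1, lt_of_le_of_ne h.2 hr⟩

theorem abs_terminal_sub_le {L : ℝ≥0} (hf : Regular f C K) (hg : LipschitzWith L g)
    (hc : c ∈ Icc t T) {u u' : ℝ → U} {v v' : ℝ → V}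
    (hu : Measurable u) (hv : Measurable v) (hu' : Measurable u') (hv' : Measurable v')
    (huu' : ∀ᵐ s, s ∈ Icc c T → u s = u' s) (hvv' : ∀ᵐ s, s ∈ Icc c T → v s = v' s) :
    |g (sol f T t x u v T) - g (sol f T c y u' v' T)| ≤
      L * Real.exp (K * (T - c)) * ‖sol f T t x u v c - y‖ := by
  have hT : T ∈ Icc c T := ⟨hc.2, le_rfl⟩
  rw [hf.sol_flow hu hv hc hT, hf.sol_congr_ae hu hv hu' hv' le_rfl huu' hvv' hT]
  have h1 := hg.dist_le_mul (sol f T c (sol f T t x u v c) u' v' T) (sol f T c y u' v' T)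
  rw [Real.dist_eq, dist_eq_norm] at h1
  refine h1.trans ?_
  rw [mul_assoc, mul_comm (Real.exp _)]
  exact mul_le_mul_of_nonneg_left (hf.norm_sol_sub_sol_le hu' hv' hT) L.2

/-- The state at the end of a stage as a function of the randomization of that stage. -/
def stageState (f : ℝ → EuclideanSpace ℝ (Fin d) → U → V → EuclideanSpace ℝ (Fin d)) (T t c : ℝ)
    (x : EuclideanSpace ℝ (Fin d)) (u : ℝ → I → U) (v : ℝ → I → V) (z : I × I) :
    EuclideanSpace ℝ (Fin d) :=
  sol f T t x (fun r => u r z.1) (fun r => v r z.2) c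

theorem measurable_stageState (hf : Regular f C K) (hc : c ∈ Icc t T) {u : ℝ → I → U}
    {v : ℝ → I → V} (hu : Measurable (Function.uncurry u)) (hv : Measurable (Function.uncurry v)) :
    Measurable (stageState f T t c x u v) := by
  have h1 : Measurable fun q : ℝ × I × I => (q.1, q.2.1) := by fun_prop
  have h2 : Measurable fun q : ℝ × I × I => (q.1, q.2.2) := by fun_prop
  have hu' : Measurable (Function.uncurry fun (r : ℝ) (z : I × I) => u r z.1) := hu.comp h1
  have hv' : Measurable (Function.uncurry fun (r : ℝ) (z : I × I) => v r z.2) := hv.comp h2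
  exact hf.measurable_sol hu' hv' hc

theorem measurable_stageState_Fsig (hf : Regular f C K) (hc : c ∈ Icc t T) {N : Omega → ℕ}
    (hN : Measurable[Fsig j] N) {u : ℕ → ℝ → I → U} {v : ℕ → ℝ → I → V}
    (hu : ∀ k, Measurable (Function.uncurry (u k)))
    (hv : ∀ k, Measurable (Function.uncurry (v k))) :
    Measurable[Fsig (j + 1)] fun ω => stageState f T t c x (u (N ω)) (v (N ω)) (ω j) :=
  measurable_diag (m := Fsig (j + 1)) (N := N)
    (F := fun k ω => stageState f T t c x (u k) (v k) (ω j))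
    (hN.mono (Fsig_mono j.le_succ) le_rfl)
    fun k => (measurable_stageState hf hc (hu k) (hv k)).comp (measurable_coord_Fsig j.lt_succ_self)

variable [Nonempty U] [Nonempty V]

theorem lowerB_step [IsProbabilityMeasure P] (hP : IsProductMeasure P) (hf : Regular f C K)
    {L L' : ℝ≥0} (hg : LipschitzWith L g) (hgM : ∀ y, |g y| ≤ M) (hw : LipschitzWith L' w)
    (hwM : ∀ y, |w y| ≤ M) (hj : j < π.n) (ht : t ∈ Ico (π.t j) (π.t (j + 1)))
    (h : ∀ y, ∀ ε : ℝ, 0 < ε → LowerB f g P π (π.t (j + 1)) (j + 1) y (w y - ε)) (hε : 0 < ε) :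
    LowerB f g P π t j x (step f T t (π.t (j + 1)) w x - ε) := by
  set c := π.t (j + 1) with hcdef
  have hcT : c ≤ T := π.t_le_last hj
  have hc : c ∈ Icc t T := ⟨ht.2.le, hcT⟩
  set B : ℝ := L * Real.exp (K * (T - c)) with hB
  have hB0 : 0 ≤ B := by positivity
  obtain ⟨δ, hδ, hδε⟩ : ∃ δ : ℝ, 0 < δ ∧ (B + L') * δ ≤ ε / 3 := by
    have h0 : 0 < B + L' + 1 := by positivity
    refine ⟨ε / 3 / (B + L' + 1), by positivity, ?_⟩
    rw [mul_div_assoc', div_le_iff₀ h0]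
    nlinarith
  obtain ⟨N, p, hN, hNp⟩ := exists_measurable_cells (E := EuclideanSpace ℝ (Fin d)) hδ
  obtain ⟨u, hu, huv⟩ := exists_step_sub_le_cost (f := f) (T := T) (t := t) (c := c) (x := x) hwM
    (by positivity : 0 < ε / 3)
  choose A hA hAv using fun m => h (p m) (ε / 3) (by positivity)
  let a : U := Classical.arbitrary U
  let u0 : ℝ → Omega → U := fun s ω => if s ∈ Ico (π.t j) (π.t (j + 1)) then u s (ω j).1 else a
  have hu0 : IsAdm Prod.fst π u0 := isAdm_interval measurable_fst hj hu a
  let X : (ℝ → Omega → V) → Omega → EuclideanSpace ℝ (Fin d) := fun v ω =>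
    sol f T t x (fun r => u0 r ω) (fun r => v r ω) c
  let α : (ℝ → Omega → V) → ℝ → Omega → U := fun v s ω =>
    if s < c then u0 s ω else A (N (X v ω)) v s ω
  have hαlt : ∀ v s ω, s < c → α v s ω = u0 s ω := fun v s ω hs => if_pos hs
  have hαge : ∀ v s ω, c ≤ s → α v s ω = A (N (X v ω)) v s ω := fun v s ω hs => if_neg hs.not_gt
  have hX : ∀ v, IsAdm Prod.snd π v → ∃ (N' : Omega → ℕ) (v' : ℕ → ℝ → I → V),
      Measurable[Fsig j] N' ∧ (∀ k, Measurable (Function.uncurry (v' k))) ∧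
      ∀ ω, X v ω = stageState f T t c x u (v' (N' ω)) (ω j) := by
    intro v hv
    obtain ⟨N', v', hN', hv', he⟩ := hv.2 j hj
    refine ⟨N', v', hN', hv', fun ω => ?_⟩
    refine sol_congr_Ico hf hc (measurable_slice hu0.1 ω) (measurable_slice hv.1 ω)
      (hu.comp measurable_prodMk_right) ((hv' _).comp measurable_prodMk_right)
      (fun s hs => if_pos ⟨ht.1.trans hs.1, hs.2⟩) fun s hs => he ω s ⟨ht.1.trans hs.1, hs.2⟩
  have hXm : ∀ v, IsAdm Prod.snd π v → Measurable[Fsig (j + 1)] (X v) := by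
    intro v hv
    obtain ⟨N', v', hN', hv', he⟩ := hX v hv
    rw [funext he]
    exact measurable_stageState_Fsig hf hc hN' (u := fun _ => u) (fun _ => hu) hv'
  have hαadm : ∀ v ∈ AdmControl2 V π, α v ∈ AdmControl1 U π := by
    intro v hv
    refine mem_admControl1_iff.2 (IsAdm.paste (l := j + 1) (N := fun ω => N (X v ω))
      (u := fun m => A m v) hj
      (hN.comp (hXm v (mem_admControl2_iff.1 hv))) hu0 fun m => ?_)
    exact mem_admControl1_iff.1 ((hA m).1 v hv)
  refine ⟨α, ⟨hαadm, ?_⟩, ?_⟩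
  · intro τ hτ v v' hv hv' hvv'
    have h1 : ∀ᵐ p ∂((volume : Measure ℝ).prod P), ∀ m, c ≤ p.1 → p.1 ≤ π.t (τ p.2 + 1) →
        A m v p.1 p.2 = A m v' p.1 p.2 := ae_all_iff.2 fun m =>
      (hA m).2 τ hτ v v' hv hv' (by
        filter_upwards [hvv'] with p hp h1 h2
        exact hp (hc.1.trans h1) h2)
    have h2 : ∀ᵐ ω ∂P, j + 1 ≤ τ ω → X v ω = X v' ω := by
      filter_upwards [ae_slice (Q := fun s ω => t ≤ s → s ≤ π.t (τ ω) → v s ω = v' s ω) hvv']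
        with ω hω hτω
      have hle : c ≤ π.t (τ ω) := π.t_le hτω (hτ.1 ω).le
      refine hf.sol_congr_ae (measurable_slice hu0.1 ω) (measurable_slice hv.1 ω)
        (measurable_slice hu0.1 ω) (measurable_slice hv'.1 ω) hcT
        (Eventually.of_forall fun _ _ => rfl) ?_ ⟨hc.1, le_rfl⟩
      filter_upwards [hω] with s hs hs'
      exact hs hs'.1 (hs'.2.trans hle)
    filter_upwards [h1, ae_fst_ne (P := P) c, Measure.quasiMeasurePreserving_snd.ae h2]
      with q h1 h3 h2 h4 h5
    rcases lt_or_ge q.1 c with hs | hs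
    · rw [hαlt _ _ _ hs, hαlt _ _ _ hs]
    · have hτj : j + 1 ≤ τ q.2 := by
        by_contra! hlt
        have := π.t_le (i := τ q.2 + 1) (j := j + 1) hlt hj
        exact h3 (le_antisymm (h5.trans this) hs)
      rw [hαge _ _ _ hs, hαge _ _ _ hs, h2 hτj]
      exact h1 _ hs h5
  · intro v hv S hS
    have hv2 := mem_admControl2_iff.1 hv
    obtain ⟨N', v', hN', hv', he⟩ := hX v hv2
    have hXm' := hXm v hv2
    have hXm0 : Measurable (X v) := hXm'.mono (Fsig_le _) le_rfl
    have hαm := (hαadm v hv).1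
    have hαX : ∀ ω, sol f T t x (fun r => α v r ω) (fun r => v r ω) c = X v ω := fun ω =>
      sol_congr_Ico hf hc (measurable_slice hαm ω) (measurable_slice hv.1 ω)
        (measurable_slice hu0.1 ω) (measurable_slice hv.1 ω) (fun s hs => hαlt _ _ _ hs.2)
        fun _ _ => rfl
    have hwi : Integrable (fun ω => w (X v ω)) P :=
      Integrable.of_bound (hw.continuous.measurable.comp hXm0).aestronglyMeasurable M
        (Eventually.of_forall fun _ => hwM _)
    have hri := integrable_run (P := P) (x := x) hf hg.continuous hgM (hc.1.trans hcT) hαm hv.1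
    have key : ∀ m, ∀ ω, N (X v ω) = m →
        run f g T c (p m) (A m v) v ω - B * δ ≤ run f g T t x (α v) v ω ∧
        w (X v ω) - L' * δ ≤ w (p m) := by
      intro m ω hm
      have hd : ‖X v ω - p m‖ ≤ δ := by
        rw [← dist_eq_norm, ← hm]
        exact (hNp _).le
      constructor
      · have h1 := abs_terminal_sub_le (x := x) (y := p m) hf hg hc (measurable_slice hαm ω)
          (measurable_slice hv.1 ω) (measurable_slice ((hA m).1 v hv).1 ω)
          (measurable_slice hv.1 ω)
          (Eventually.of_forall fun s hs => by rw [hαge _ _ _ hs.1, hm])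
          (Eventually.of_forall fun s hs => rfl)
        rw [hαX] at h1
        have h2 := (abs_le.1 (h1.trans (mul_le_mul_of_nonneg_left hd hB0))).1
        unfold run
        linarith
      · have h1 := hw.dist_le_mul (X v ω) (p m)
        rw [Real.dist_eq, dist_eq_norm] at h1
        have h2 := (abs_le.1 (h1.trans (mul_le_mul_of_nonneg_left hd L'.2))).2
        linarith
    have hcell : ∫ ω in S, (w (X v ω) - 2 * (ε / 3)) ∂P ≤ ∫ ω in S, run f g T t x (α v) v ω ∂P := by
      refine setIntegral_le_of_cells (Fsig_le j _ hS) (N := fun ω => N (X v ω)) (hN.comp hXm0)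
        (hwi.sub (integrable_const _)) hri fun m => ?_
      have hD : MeasurableSet[Fsig (j + 1)] (S ∩ (fun ω => N (X v ω)) ⁻¹' {m}) :=
        @MeasurableSet.inter _ (Fsig (j + 1)) _ _ (Fsig_mono j.le_succ _ hS)
          ((hN.comp hXm') (measurableSet_singleton m))
      have hD' := Fsig_le _ _ hD
      have hrm := integrable_run (P := P) (x := p m) hf hg.continuous hgM hcT ((hA m).1 v hv).1 hv.1
      calc ∫ ω in S ∩ (fun ω => N (X v ω)) ⁻¹' {m}, (w (X v ω) - 2 * (ε / 3)) ∂P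
          ≤ ∫ ω in S ∩ (fun ω => N (X v ω)) ⁻¹' {m}, (w (p m) - ε / 3 - B * δ) ∂P := by
            refine setIntegral_mono_on (hwi.sub (integrable_const _)).integrableOn
              (integrable_const _).integrableOn hD' fun ω hω => ?_
            have := (key m ω hω.2).2
            nlinarith
        _ = (w (p m) - ε / 3) * P.real (S ∩ (fun ω => N (X v ω)) ⁻¹' {m}) -
              B * δ * P.real (S ∩ (fun ω => N (X v ω)) ⁻¹' {m}) := by
            rw [setIntegral_const, smul_eq_mul]; ring
        _ ≤ (∫ ω in S ∩ (fun ω => N (X v ω)) ⁻¹' {m}, run f g T c (p m) (A m v) v ω ∂P) -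
              B * δ * P.real (S ∩ (fun ω => N (X v ω)) ⁻¹' {m}) :=
            sub_le_sub_right (hAv m v hv _ hD) _
        _ = ∫ ω in S ∩ (fun ω => N (X v ω)) ⁻¹' {m},
              (run f g T c (p m) (A m v) v ω - B * δ) ∂P := by
            rw [integral_sub hrm.integrableOn (integrable_const _).integrableOn,
              setIntegral_const, smul_eq_mul]
            ring
        _ ≤ _ := setIntegral_mono_on (hrm.sub (integrable_const _)).integrableOn hri.integrableOn
            hD' fun ω hω => (key m ω hω.2).1
    refine le_trans ?_ hcell
    rw [integral_sub hwi.integrableOn (integrable_const _).integrableOn, setIntegral_const,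
      smul_eq_mul]
    have hfr := le_setIntegral_frozen hP hS hN' (a := step f T t c w x - ε / 3) (M := M)
      (ψ := fun k z => w (stageState f T t c x u (v' k) z))
      (fun k => hw.continuous.measurable.comp (measurable_stageState hf hc hu (hv' k)))
      (fun k z => hwM _) fun k => by
        have hi : Integrable (fun z : I × I => w (stageState f T t c x u (v' k) z)) volume :=
          Integrable.of_bound (hw.continuous.measurable.comp
            (measurable_stageState hf hc hu (hv' k))).aestronglyMeasurable M
            (Eventually.of_forall fun _ => hwM _)
        rw [Measure.volume_eq_prod] at hi ⊢
        rw [integral_prod_symm _ hi]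
        have h1 : ∫ _ : I, (step f T t c w x - ε / 3) ≤
            ∫ z2 : I, ∫ z1 : I, w (stageState f T t c x u (v' k) (z1, z2)) :=
          integral_mono (integrable_const _) hi.integral_prod_right fun z2 =>
            huv (fun r => v' k r z2) ((hv' k).comp measurable_prodMk_right)
        simpa using h1
    have h2 : ∫ ω in S, w (X v ω) ∂P =
        ∫ ω in S, w (stageState f T t c x u (v' (N' ω)) (ω j)) ∂P := by
      simp_rw [he]
    rw [h2]
    linarith

end Stage

section Stage2

set_option linter.unusedSectionVars false

variable {d : ℕ} {U V : Type} [MetricSpace U] [CompactSpace U] [MetricSpace V] [CompactSpace V]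
  [MeasurableSpace U] [BorelSpace U] [MeasurableSpace V] [BorelSpace V]
  {f : ℝ → EuclideanSpace ℝ (Fin d) → U → V → EuclideanSpace ℝ (Fin d)} {C : ℝ} {K : ℝ≥0}
  {T t c M ε : ℝ} {g w : EuclideanSpace ℝ (Fin d) → ℝ} {x y : EuclideanSpace ℝ (Fin d)}
  {P : Measure Omega} {π : Partition T} {j : ℕ}

theorem IsNAD1.eq_on_cell [IsProbabilityMeasure P]
    {α : (ℝ → Omega → V) → (ℝ → Omega → U)} (hα : IsNAD1 U V P π t α)
    (hj : j < π.n) (ht : t ∈ Ico (π.t j) (π.t (j + 1))) {D : Set Omega}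
    (hD : MeasurableSet[Fsig (j + 1)] D) {v v' : ℝ → Omega → V} (hv : v ∈ AdmControl2 V π)
    (hv' : v' ∈ AdmControl2 V π) (h1 : ∀ s ω, s < π.t (j + 1) → v s ω = v' s ω)
    (h2 : ∀ s, ∀ ω ∈ D, v s ω = v' s ω) :
    ∀ᵐ q ∂((volume : Measure ℝ).prod P), q.2 ∈ D → t ≤ q.1 → q.1 ≤ T →
      α v q.1 q.2 = α v' q.1 q.2 := by
  classical
  rcases Nat.lt_or_ge (j + 1) π.n with hjn | hjn
  · let τ : Omega → ℕ := fun ω => if ω ∈ D then π.n - 1 else j + 1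
    have hτm : Measurable[Fsig (j + 1)] τ :=
      Measurable.ite (hp := hD) (@measurable_const _ _ _ (Fsig (j + 1)) _)
        (@measurable_const _ _ _ (Fsig (j + 1)) _)
    have hτ : IsStoppingIdx π τ := by
      refine ⟨fun ω => ?_, fun i => ?_⟩
      · by_cases hω : ω ∈ D <;> simp [τ, hω] <;> omega
      · rcases Nat.lt_or_ge i (j + 1) with hi | hi
        · have : {ω | τ ω = i} = ∅ := by
            ext ω
            by_cases hω : ω ∈ D <;> simp [τ, hω] <;> omega
          rw [this]
          exact @MeasurableSet.empty _ (Fsig i)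
        · exact Fsig_mono hi _ (hτm (measurableSet_singleton i))
    have h3 : aeStEq P t (fun ω => π.t (τ ω)) v v' := by
      filter_upwards [ae_fst_ne (P := P) (π.t (j + 1))] with q hq _ hle
      by_cases hω : q.2 ∈ D
      · exact h2 _ _ hω
      · have hq' : q.1 ≤ π.t (j + 1) := by simpa [τ, hω] using hle
        exact h1 _ _ (lt_of_le_of_ne hq' hq)
    filter_upwards [hα.2 τ hτ v v' hv hv' h3] with q hq hD' h4 h5
    refine hq h4 ?_
    have h6 : τ q.2 + 1 = π.n := by
      have := π.npos
      simp only [τ, if_pos hD']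
      omega
    rw [h6, π.map_last]
    exact h5
  · have h6 : j + 1 = π.n := le_antisymm hj hjn
    filter_upwards [hα.2 _ (isStoppingIdx_const hj) v v' hv hv' (aeStEq_of_le v v' ht.1)]
      with q hq _ h4 h5
    refine hq h4 ?_
    rw [h6, π.map_last]
    exact h5

variable [Nonempty U] [Nonempty V]

theorem upperB_step [IsProbabilityMeasure P] (hP : IsProductMeasure P) (hf : Regular f C K)
    {L L' : ℝ≥0} (hg : LipschitzWith L g) (hgM : ∀ y, |g y| ≤ M) (hw : LipschitzWith L' w)
    (hwM : ∀ y, |w y| ≤ M) (hj : j < π.n) (ht : t ∈ Ico (π.t j) (π.t (j + 1)))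
    (h : ∀ y, ∀ ε : ℝ, 0 < ε → UpperB f g P π (π.t (j + 1)) (j + 1) y (w y + ε)) (hε : 0 < ε) :
    UpperB f g P π t j x (step f T t (π.t (j + 1)) w x + ε) := by
  set c := π.t (j + 1) with hcdef
  have hcT : c ≤ T := π.t_le_last hj
  have hc : c ∈ Icc t T := ⟨ht.2.le, hcT⟩
  set B : ℝ := L * Real.exp (K * (T - c)) with hB
  have hB0 : 0 ≤ B := by positivity
  obtain ⟨δ, hδ, hδε⟩ : ∃ δ : ℝ, 0 < δ ∧ (B + L') * δ ≤ ε / 3 := by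
    have h0 : 0 < B + L' + 1 := by positivity
    refine ⟨ε / 3 / (B + L' + 1), by positivity, ?_⟩
    rw [mul_div_assoc', div_le_iff₀ h0]
    nlinarith
  obtain ⟨N, p, hN, hNp⟩ := exists_measurable_cells (E := EuclideanSpace ℝ (Fin d)) hδ
  intro α hα
  let b : V := Classical.arbitrary V
  let v0 : ℝ → Omega → V := fun _ _ => b
  have hv0 : IsAdm Prod.snd π v0 := isAdm_deterministic measurable_const
  let u0 := α v0
  have hu0 : IsAdm Prod.fst π u0 := mem_admControl1_iff.1 (hα.1 _ (mem_admControl2_iff.2 hv0))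
  obtain ⟨N', u, hN', hu, heu⟩ := hu0.2 j hj
  choose vt hvt hvtc using fun k => exists_cost_le_step_add (f := f) (T := T) (t := t) (c := c)
    (x := x) hwM (by positivity : 0 < ε / 3) (hu k)
  let v1 : ℝ → Omega → V := fun s ω => if s < π.t j then v0 s ω else vt (N' ω) s
  have hv1 : IsAdm Prod.snd π v1 :=
    IsAdm.paste (l := j) (N := N') (u := fun m s _ => vt m s) hj.le hN' hv0
      fun m => isAdm_deterministic (hvt m)
  have hvt' : ∀ k, Measurable (Function.uncurry fun (r : ℝ) (_ : I) => vt k r) := fun k =>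
    (hvt k).comp measurable_fst
  let X : Omega → EuclideanSpace ℝ (Fin d) := fun ω =>
    stageState f T t c x (u (N' ω)) (fun r _ => vt (N' ω) r) (ω j)
  have hXm : Measurable[Fsig (j + 1)] X :=
    measurable_stageState_Fsig (v := fun k r _ => vt k r) hf hc hN' hu hvt'
  have hXm0 : Measurable X := hXm.mono (Fsig_le _) le_rfl
  let ext : (ℝ → Omega → V) → ℝ → Omega → V := fun v' s ω => if s < c then v1 s ω else v' s ω
  have hext : ∀ v' ∈ AdmControl2 V π, ext v' ∈ AdmControl2 V π := fun v' hv' =>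
    mem_admControl2_iff.2 (IsAdm.paste (l := j + 1) (N := fun _ => 0) (u := fun _ => v') hj
      (@measurable_const _ _ _ (Fsig _) _) hv1 fun _ => mem_admControl2_iff.1 hv')
  have hα' : IsNAD1 U V P π c fun v' => α (ext v') := by
    refine ⟨fun v' hv' => hα.1 _ (hext v' hv'), fun τ hτ v' v'' hv' hv'' he => ?_⟩
    filter_upwards [hα.2 τ hτ _ _ (hext v' hv') (hext v'' hv'') (by
      filter_upwards [he] with q hq _ h2
      rcases lt_or_ge q.1 c with hs | hs
      · simp only [ext, if_pos hs]
      · simp only [ext, if_neg hs.not_gt]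
        exact hq hs h2)] with q hq h1 h2
    exact hq (hc.1.trans h1) h2
  choose A hA hAv using fun m => h (p m) (ε / 3) (by positivity) _ hα'
  let v : ℝ → Omega → V := fun s ω => if s < c then v1 s ω else A (N (X ω)) s ω
  have hvadm : IsAdm Prod.snd π v :=
    IsAdm.paste (l := j + 1) (N := fun ω => N (X ω)) (u := A) hj (hN.comp hXm) hv1
      fun m => mem_admControl2_iff.1 (hA m)
  have hv := mem_admControl2_iff.2 hvadm
  refine ⟨v, hv, fun S hS => ?_⟩
  have hαm := (hα.1 v hv).1
  have hαmm : ∀ m, Measurable (Function.uncurry (α (ext (A m)))) := fun m =>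
    (hα.1 _ (hext _ (hA m))).1
  have hαX : ∀ᵐ ω ∂P, sol f T t x (fun r => α v r ω) (fun r => v r ω) c = X ω := by
    have h1 : aeStEq P t (fun _ => c) (α v) u0 := hα.2 _ (isStoppingIdx_const hj) v v0 hv
      (mem_admControl2_iff.2 hv0) (aeStEq_of_le v v0 ht.1)
    filter_upwards [ae_slice (Q := fun s ω => t ≤ s → s ≤ c → α v s ω = u0 s ω) h1] with ω hω
    have hne : ∀ᵐ r : ℝ, r ≠ c := compl_mem_ae_iff.2 (by simp : volume {c} = 0)
    refine hf.sol_congr_ae (measurable_slice hαm ω) (measurable_slice hvadm.1 ω)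
      ((hu _).comp measurable_prodMk_right) (hvt _) hcT ?_ ?_ ⟨hc.1, le_rfl⟩
    · filter_upwards [hω, hne] with s hs hsc hs'
      rw [hs hs'.1 hs'.2]
      exact heu ω s ⟨ht.1.trans hs'.1, lt_of_le_of_ne hs'.2 hsc⟩
    · filter_upwards [hne] with s hsc hs'
      simp only [v, v1, if_pos (lt_of_le_of_ne hs'.2 hsc), if_neg (ht.1.trans hs'.1).not_gt]
  have hNX : ∀ m, MeasurableSet[Fsig (j + 1)] ((fun ω => N (X ω)) ⁻¹' {m}) := fun m =>
    (hN.comp hXm) (measurableSet_singleton m)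
  have hcellα : ∀ᵐ ω ∂P, ∀ m, N (X ω) = m → ∀ᵐ s, s ∈ Icc c T → α v s ω = α (ext (A m)) s ω := by
    refine ae_all_iff.2 fun m => ?_
    have h1 := hα.eq_on_cell hj ht (hNX m) hv (hext _ (hA m))
      (fun s ω hs => by simp only [v, ext, if_pos (show s < c from hs)])
      (fun s ω hω => by
        have hω' : N (X ω) = m := hω
        simp only [v, ext, hω'])
    filter_upwards [ae_slice (Q := fun s ω => ω ∈ (fun ω => N (X ω)) ⁻¹' {m} → t ≤ s → s ≤ T →
      α v s ω = α (ext (A m)) s ω) h1] with ω hω hm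
    filter_upwards [hω] with s hs hs'
    exact hs hm (hc.1.trans hs'.1) hs'.2
  have hwi : Integrable (fun ω => w (X ω)) P :=
    Integrable.of_bound (hw.continuous.measurable.comp hXm0).aestronglyMeasurable M
      (Eventually.of_forall fun _ => hwM _)
  have hri := integrable_run (P := P) (x := x) hf hg.continuous hgM (hc.1.trans hcT) hαm hvadm.1
  have hd : ∀ m ω, N (X ω) = m → ‖X ω - p m‖ ≤ δ := fun m ω hm => by
    rw [← dist_eq_norm, ← hm]
    exact (hNp _).le
  have key : ∀ᵐ ω ∂P, ∀ m, N (X ω) = m →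
      run f g T t x (α v) v ω ≤ run f g T c (p m) (α (ext (A m))) (A m) ω + B * δ := by
    filter_upwards [hαX, hcellα] with ω h1 h2 m hm
    have h3 := abs_terminal_sub_le (x := x) (y := p m) hf hg hc (measurable_slice hαm ω)
      (measurable_slice hvadm.1 ω) (measurable_slice (hαmm m) ω)
      (measurable_slice (hA m).1 ω) (h2 m hm)
      (Eventually.of_forall fun s hs => by simp only [v, if_neg hs.1.not_gt, hm])
    rw [h1] at h3
    have h4 := (abs_le.1 (h3.trans (mul_le_mul_of_nonneg_left (hd m ω hm) hB0))).2
    unfold run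
    linarith
  have keyw : ∀ m ω, N (X ω) = m → w (p m) ≤ w (X ω) + L' * δ := by
    intro m ω hm
    have h1 := hw.dist_le_mul (X ω) (p m)
    rw [Real.dist_eq, dist_eq_norm] at h1
    have h2 := (abs_le.1 (h1.trans (mul_le_mul_of_nonneg_left (hd m ω hm) L'.2))).1
    linarith
  have hcell : ∫ ω in S, run f g T t x (α v) v ω ∂P ≤ ∫ ω in S, (w (X ω) + 2 * (ε / 3)) ∂P := by
    refine setIntegral_le_of_cells (Fsig_le j _ hS) (N := fun ω => N (X ω)) (hN.comp hXm0)
      hri (hwi.add (integrable_const _)) fun m => ?_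
    have hD : MeasurableSet[Fsig (j + 1)] (S ∩ (fun ω => N (X ω)) ⁻¹' {m}) :=
      @MeasurableSet.inter _ (Fsig (j + 1)) _ _ (Fsig_mono j.le_succ _ hS) (hNX m)
    have hD' := Fsig_le _ _ hD
    have hrm := integrable_run (P := P) (x := p m) hf hg.continuous hgM hcT (hαmm m) (hA m).1
    calc ∫ ω in S ∩ (fun ω => N (X ω)) ⁻¹' {m}, run f g T t x (α v) v ω ∂P
        ≤ ∫ ω in S ∩ (fun ω => N (X ω)) ⁻¹' {m},
            (run f g T c (p m) (α (ext (A m))) (A m) ω + B * δ) ∂P := by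
          refine setIntegral_mono_on_ae hri.integrableOn
            (hrm.add (integrable_const _)).integrableOn hD' ?_
          filter_upwards [key] with ω hω hω'
          exact hω m hω'.2
      _ = (∫ ω in S ∩ (fun ω => N (X ω)) ⁻¹' {m},
            run f g T c (p m) (α (ext (A m))) (A m) ω ∂P) +
            B * δ * P.real (S ∩ (fun ω => N (X ω)) ⁻¹' {m}) := by
          rw [integral_add hrm.integrableOn (integrable_const _).integrableOn,
            setIntegral_const, smul_eq_mul]
          ring
      _ ≤ (w (p m) + ε / 3) * P.real (S ∩ (fun ω => N (X ω)) ⁻¹' {m}) +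
            B * δ * P.real (S ∩ (fun ω => N (X ω)) ⁻¹' {m}) :=
          add_le_add_left (hAv m _ hD) _
      _ = ∫ ω in S ∩ (fun ω => N (X ω)) ⁻¹' {m}, (w (p m) + ε / 3 + B * δ) ∂P := by
          rw [setIntegral_const, smul_eq_mul]; ring
      _ ≤ _ := by
          refine setIntegral_mono_on (integrable_const _).integrableOn
            (hwi.add (integrable_const _)).integrableOn hD' fun ω hω => ?_
          have := keyw m ω hω.2
          nlinarith
  refine hcell.trans ?_
  rw [integral_add hwi.integrableOn (integrable_const _).integrableOn, setIntegral_const,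
    smul_eq_mul]
  have hm := fun k => hw.continuous.measurable.comp
    (measurable_stageState (x := x) hf hc (hu k) (hvt' k))
  have hfr := setIntegral_frozen_le hP hS hN' (a := step f T t c w x + ε / 3) (M := M)
    (ψ := fun k z => w (stageState f T t c x (u k) (fun r _ => vt k r) z)) hm
    (fun k z => hwM _) fun k => by
      have hi : Integrable
          (fun z : I × I => w (stageState f T t c x (u k) (fun r _ => vt k r) z)) volume :=
        Integrable.of_bound (hm k).aestronglyMeasurable M (Eventually.of_forall fun _ => hwM _)
      rw [Measure.volume_eq_prod] at hi ⊢
      rw [integral_prod _ hi]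
      refine le_trans (le_of_eq ?_) (hvtc k)
      simp [stageState, cost]
  linarith

end Stage2

section Value

set_option linter.unusedSectionVars false

variable {d : ℕ} {U V : Type} [MetricSpace U] [CompactSpace U] [MetricSpace V] [CompactSpace V]
  [MeasurableSpace U] [BorelSpace U] [MeasurableSpace V] [BorelSpace V] [Nonempty U] [Nonempty V]
  {f : ℝ → EuclideanSpace ℝ (Fin d) → U → V → EuclideanSpace ℝ (Fin d)} {C : ℝ} {K L : ℝ≥0}
  {T t M : ℝ} {g : EuclideanSpace ℝ (Fin d) → ℝ} {x : EuclideanSpace ℝ (Fin d)}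
  {P : Measure Omega} [IsProbabilityMeasure P] {π : Partition T} {j : ℕ}

theorem setIntegral_run_terminal (hf : Regular f C K) {u : ℝ → Omega → U} {v : ℝ → Omega → V}
    (hu : Measurable (Function.uncurry u)) (hv : Measurable (Function.uncurry v)) (A : Set Omega) :
    ∫ ω in A, run f g T T x u v ω ∂P = g x * P.real A := by
  have h : ∀ ω, run f g T T x u v ω = g x := fun ω => by
    rw [run, hf.sol_init (measurable_slice hu ω) (measurable_slice hv ω) le_rfl]
  simp_rw [h]
  rw [setIntegral_const, smul_eq_mul, mul_comm]

theorem lowerB_terminal (hf : Regular f C K) {a : ℝ} (ha : a ≤ g x) :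
    LowerB f g P π T j x a := by
  have hu : (fun _ _ => Classical.arbitrary U : ℝ → Omega → U) ∈ AdmControl1 U π :=
    mem_admControl1_iff.2 (isAdm_deterministic measurable_const)
  refine ⟨_, isNAD1_const hu, fun v hv A _ => ?_⟩
  rw [setIntegral_run_terminal hf hu.1 hv.1]
  exact mul_le_mul_of_nonneg_right ha measureReal_nonneg

theorem upperB_terminal (hf : Regular f C K) {a : ℝ} (ha : g x ≤ a) :
    UpperB f g P π T j x a := by
  intro α hα
  have hv : (fun _ _ => Classical.arbitrary V : ℝ → Omega → V) ∈ AdmControl2 V π :=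
    mem_admControl2_iff.2 (isAdm_deterministic measurable_const)
  refine ⟨_, hv, fun A _ => ?_⟩
  rw [setIntegral_run_terminal hf (hα.1 _ hv).1 hv.1]
  exact mul_le_mul_of_nonneg_right ha measureReal_nonneg

theorem lowerValD_terminal (hT : 0 ≤ T) (hf : Regular f C K) (hg : Continuous g)
    (hgM : ∀ y, |g y| ≤ M) : lowerValD U V f g P π T x = g x :=
  lowerValD_eq hf hg hgM ⟨hT, le_rfl⟩ (fun _ hε => lowerB_terminal hf (by linarith))
    fun _ hε => upperB_terminal hf (by linarith)

/-- Regularity of the lower value at the `k`-th node, together with the existence of almost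
optimal strategies and responses there. -/
structure NodeRegular (f : ℝ → EuclideanSpace ℝ (Fin d) → U → V → EuclideanSpace ℝ (Fin d))
    (g : EuclideanSpace ℝ (Fin d) → ℝ) (P : Measure Omega) (π : Partition T) (M : ℝ) (k : ℕ) :
    Prop where
  lip : ∃ L' : ℝ≥0, LipschitzWith L' (lowerValD U V f g P π (π.t k))
  bdd : ∀ y, |lowerValD U V f g P π (π.t k) y| ≤ M
  lower : ∀ y, ∀ ε : ℝ, 0 < ε →
    LowerB f g P π (π.t k) k y (lowerValD U V f g P π (π.t k) y - ε)
  upper : ∀ y, ∀ ε : ℝ, 0 < ε →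
    UpperB f g P π (π.t k) k y (lowerValD U V f g P π (π.t k) y + ε)

theorem NodeRegular.lowerValD_eq_step (hP : IsProductMeasure P) (hf : Regular f C K)
    (hg : LipschitzWith L g) (hgM : ∀ y, |g y| ≤ M) (hj : j < π.n)
    (ht : t ∈ Ico (π.t j) (π.t (j + 1))) (h : NodeRegular f g P π M (j + 1)) :
    lowerValD U V f g P π t x =
      step f T t (π.t (j + 1)) (lowerValD U V f g P π (π.t (j + 1))) x := by
  obtain ⟨L', hL'⟩ := h.lip
  refine lowerValD_eq hf hg.continuous hgM
    ⟨(π.t_nonneg hj.le).trans ht.1, ht.2.le.trans (π.t_le_last hj)⟩ (fun ε hε => ?_) fun ε hε => ?_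
  · rw [π.idx_eq hj ht.1 ht.2]
    exact lowerB_step hP hf hg hgM hL' h.bdd hj ht h.lower hε
  · rw [π.idx_eq hj ht.1 ht.2]
    exact upperB_step hP hf hg hgM hL' h.bdd hj ht h.upper hε

theorem nodeRegular (hP : IsProductMeasure P) (hf : Regular f C K)
    (hg : LipschitzWith L g) (hgM : ∀ y, |g y| ≤ M) {k : ℕ} (hk : k ≤ π.n) :
    NodeRegular f g P π M k := by
  induction hk using Nat.decreasingInduction with
  | self =>
    have hT : 0 ≤ T := π.map_last ▸ π.t_nonneg le_rfl
    have h : lowerValD U V f g P π (π.t π.n) = g := by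
      rw [π.map_last]
      exact funext fun y => lowerValD_terminal hT hf hg.continuous hgM
    refine ⟨⟨L, h.symm ▸ hg⟩, fun y => h.symm ▸ hgM y, fun y ε hε => ?_, fun y ε hε => ?_⟩ <;>
      rw [h, π.map_last]
    · exact lowerB_terminal hf (by linarith)
    · exact upperB_terminal hf (by linarith)
  | of_succ j hj ih =>
    obtain ⟨L', hL'⟩ := ih.lip
    have ht : π.t j ∈ Ico (π.t j) (π.t (j + 1)) := ⟨le_rfl, π.mono j hj⟩
    have h : ∀ y, lowerValD U V f g P π (π.t j) y =
        step f T (π.t j) (π.t (j + 1)) (lowerValD U V f g P π (π.t (j + 1))) y := fun y =>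
      ih.lowerValD_eq_step hP hf hg hgM hj ht
    refine ⟨⟨L' * (Real.exp (K * (π.t (j + 1) - π.t j))).toNNReal, ?_⟩, fun y => ?_,
      fun y ε hε => ?_, fun y ε hε => ?_⟩
    · rw [funext h]
      exact lipschitzWith_step hf hL' ih.bdd ⟨ht.2.le, π.t_le_last hj⟩
    · rw [h]
      exact abs_step_le ih.bdd
    · rw [h]
      exact lowerB_step hP hf hg hgM hL' ih.bdd hj ht ih.lower hε
    · rw [h]
      exact upperB_step hP hf hg hgM hL' ih.bdd hj ht ih.upper hε

end Value

section OneStep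

set_option linter.unusedSectionVars false

variable {d : ℕ} {U V : Type} [MetricSpace U] [CompactSpace U] [MetricSpace V] [CompactSpace V]
  [MeasurableSpace U] [BorelSpace U] [MeasurableSpace V] [BorelSpace V]
  {f : ℝ → EuclideanSpace ℝ (Fin d) → U → V → EuclideanSpace ℝ (Fin d)} {C : ℝ} {K : ℝ≥0}
  {T t t₀ c ε : ℝ} {x x₀ p : EuclideanSpace ℝ (Fin d)}

theorem Regular.exists_uniform_close (hf : Regular f C K) (t₀ : ℝ)
    (x₀ : EuclideanSpace ℝ (Fin d)) (hε : 0 < ε) :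
    ∃ ρ > 0, ∀ r y, |r - t₀| < ρ → ‖y - x₀‖ < ρ →
      ∀ a b, ‖f r y a b - f t₀ x₀ a b‖ ≤ ε := by
  let F : C((ℝ × EuclideanSpace ℝ (Fin d)) × (U × V), EuclideanSpace ℝ (Fin d)) :=
    ⟨fun q => f q.1.1 q.1.2 q.2.1 q.2.2, hf.cont.comp (by fun_prop :
      Continuous fun q : (ℝ × EuclideanSpace ℝ (Fin d)) × (U × V) =>
        (q.1.1, q.1.2, q.2.1, q.2.2))⟩
  obtain ⟨ρ, hρ, h⟩ := Metric.continuous_iff.1 F.curry.continuous (t₀, x₀) ε hε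
  refine ⟨ρ, hρ, fun r y hr hy a b => ?_⟩
  have h1 := h (r, y) (by
    rw [Prod.dist_eq, max_lt_iff, Real.dist_eq, dist_eq_norm]
    exact ⟨hr, hy⟩)
  have h2 := (ContinuousMap.dist_apply_le_dist (f := F.curry (r, y)) (g := F.curry (t₀, x₀))
    (a, b)).trans h1.le
  rwa [dist_eq_norm] at h2

theorem Regular.continuous_pair (hf : Regular f C K) (t : ℝ) (x : EuclideanSpace ℝ (Fin d)) :
    Continuous fun z : U × V => f t x z.1 z.2 :=
  hf.cont.comp (by fun_prop : Continuous fun z : U × V => (t, x, z.1, z.2))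

theorem Regular.inner_ftilde (hf : Regular f C K) (μ : ProbabilityMeasure U)
    (ν : ProbabilityMeasure V) :
    ⟪ftilde U V f t x μ ν, p⟫ =
      ∫ b, ∫ a, ⟪p, f t x a b⟫ ∂(μ : Measure U) ∂(ν : Measure V) := by
  have hi : Integrable (fun z : U × V => f t x z.1 z.2) ((μ : Measure U).prod (ν : Measure V)) :=
    Integrable.of_bound (hf.continuous_pair t x).aestronglyMeasurable C
      (Eventually.of_forall fun _ => hf.bdd _ _ _ _)
  have hi' : Integrable (fun z : U × V => ⟪p, f t x z.1 z.2⟫)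
      ((μ : Measure U).prod (ν : Measure V)) := hi.const_inner p
  rw [ftilde, ← integral_prod _ hi, real_inner_comm, ← integral_inner hi, integral_prod_symm _ hi']

theorem Regular.abs_inner_le (hf : Regular f C K) (a : U) (b : V) :
    |⟪p, f t x a b⟫| ≤ ‖p‖ * C :=
  (abs_real_inner_le_norm _ _).trans
    (mul_le_mul_of_nonneg_left (hf.bdd _ _ _ _) (norm_nonneg _))

theorem Regular.exists_response [Nonempty V] (hf : Regular f C K) (μ : ProbabilityMeasure U)
    (hε : 0 < ε) : ∃ b, ∫ a, ⟪p, f t x a b⟫ ∂(μ : Measure U) ≤ ham U V f t x p + ε := by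
  have hbd : ∀ (μ : ProbabilityMeasure U) (ν : ProbabilityMeasure V),
      |⟪ftilde U V f t x μ ν, p⟫| ≤ ‖p‖ * C := by
    intro μ ν
    rw [hf.inner_ftilde, ← Real.norm_eq_abs]
    refine (norm_integral_le_of_norm_le_const (C := ‖p‖ * C)
      (Eventually.of_forall fun b => ?_)).trans (by simp)
    refine (norm_integral_le_of_norm_le_const (C := ‖p‖ * C)
      (Eventually.of_forall fun a => ?_)).trans (by simp)
    exact hf.abs_inner_le a b
  have : Nonempty (ProbabilityMeasure V) := ⟨⟨Measure.dirac (Classical.arbitrary V), inferInstance⟩⟩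
  have h1 : ⨅ ν : ProbabilityMeasure V, ⟪ftilde U V f t x μ ν, p⟫ ≤ ham U V f t x p := by
    refine le_ciSup (f := fun μ : ProbabilityMeasure U =>
      ⨅ ν : ProbabilityMeasure V, ⟪ftilde U V f t x μ ν, p⟫) ⟨‖p‖ * C, ?_⟩ μ
    rintro _ ⟨μ, rfl⟩
    exact (ciInf_le ⟨-(‖p‖ * C), by rintro _ ⟨ν, rfl⟩; exact (abs_le.1 (hbd _ _)).1⟩
      (Classical.arbitrary _)).trans (abs_le.1 (hbd _ _)).2
  obtain ⟨ν, hν⟩ := exists_lt_of_ciInf_lt (h1.trans_lt (lt_add_of_pos_right _ hε))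
  rw [hf.inner_ftilde] at hν
  have hi : Integrable (fun z : U × V => ⟪p, f t x z.1 z.2⟫)
      ((μ : Measure U).prod (ν : Measure V)) :=
    Integrable.of_bound (continuous_const.inner (hf.continuous_pair t x)).aestronglyMeasurable
      (‖p‖ * C)
      (Eventually.of_forall fun _ => hf.abs_inner_le _ _)
  obtain ⟨b, hb⟩ := exists_le_integral hi.integral_prod_right
  exact ⟨b, hb.trans hν.le⟩

theorem Regular.exists_response_control [Nonempty V] (hf : Regular f C K) {u : ℝ → I → U}
    (hu : Measurable (Function.uncurry u)) (htc : t < c) (hε : 0 < ε) :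
    ∃ b, ∫ q, ⟪p, f t₀ x₀ (u q.1 q.2) b⟫ ∂((volume.restrict (Ioc t c)).prod (volume : Measure I)) ≤
      (c - t) * (ham U V f t₀ x₀ p + ε) := by
  set κ := (volume.restrict (Ioc t c)).prod (volume : Measure I) with hκ
  have huniv : κ.real univ = c - t := by
    rw [hκ, ← univ_prod_univ, measureReal_prod_prod]
    simp [htc.le]
  have hpos : 0 < c - t := sub_pos.2 htc
  have : NeZero κ := ⟨fun h => by simp [h] at huniv; linarith⟩
  have hν : IsProbabilityMeasure ((κ univ)⁻¹ • κ) := inferInstance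
  let μ : ProbabilityMeasure U := ⟨((κ univ)⁻¹ • κ).map (Function.uncurry u),
    Measure.isProbabilityMeasure_map hu.aemeasurable⟩
  obtain ⟨b, hb⟩ := hf.exists_response (t := t₀) (x := x₀) (p := p) μ hε
  refine ⟨b, ?_⟩
  have hcont : Continuous fun a => ⟪p, f t₀ x₀ a b⟫ :=
    continuous_const.inner
      ((hf.continuous_pair t₀ x₀).comp (by fun_prop : Continuous fun a : U => (a, b)))
  have h1 : ∫ a, ⟪p, f t₀ x₀ a b⟫ ∂(μ : Measure U) =
      (c - t)⁻¹ * ∫ q, ⟪p, f t₀ x₀ (u q.1 q.2) b⟫ ∂κ := by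
    rw [show (μ : Measure U) = ((κ univ)⁻¹ • κ).map (Function.uncurry u) from rfl,
      integral_map hu.aemeasurable hcont.aestronglyMeasurable, ← huniv, ← smul_eq_mul,
      ← average_eq]
    rfl
  rw [h1, inv_mul_le_iff₀ hpos] at hb
  exact hb

end OneStep

section Viscosity

set_option linter.unusedSectionVars false

variable {d : ℕ} {U V : Type} [MetricSpace U] [CompactSpace U] [MetricSpace V] [CompactSpace V]
  [MeasurableSpace U] [BorelSpace U] [MeasurableSpace V] [BorelSpace V]
  {f : ℝ → EuclideanSpace ℝ (Fin d) → U → V → EuclideanSpace ℝ (Fin d)} {C : ℝ} {K : ℝ≥0}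
  {φ : ℝ → EuclideanSpace ℝ (Fin d) → ℝ}
  {T t t₀ c ε : ℝ} {x x₀ p : EuclideanSpace ℝ (Fin d)}

theorem exists_abs_sub_linear_le
    (hφ : ContDiff ℝ 1 fun q : ℝ × EuclideanSpace ℝ (Fin d) => φ q.1 q.2) (t₀ : ℝ)
    (x₀ : EuclideanSpace ℝ (Fin d)) (hε : 0 < ε) :
    ∃ ρ > 0, ∀ t c x y, |t - t₀| < ρ → |c - t₀| < ρ → ‖x - x₀‖ < ρ → ‖y - x₀‖ < ρ →
      |φ c y - φ t x - (deriv (fun s => φ s x₀) t₀ * (c - t) +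
        ⟪gradient (fun y => φ t₀ y) x₀, y - x⟫)| ≤ ε * (|c - t| + ‖y - x‖) := by
  obtain ⟨Φ', hΦ⟩ : ∃ Φ', HasStrictFDerivAt
      (fun q : ℝ × EuclideanSpace ℝ (Fin d) => φ q.1 q.2) Φ' (t₀, x₀) :=
    ⟨_, hφ.contDiffAt.hasStrictFDerivAt one_ne_zero⟩
  have h1 : deriv (fun s => φ s x₀) t₀ = Φ' (1, 0) :=
    (HasFDerivAt.comp_hasDerivAt (f := fun s : ℝ => (s, x₀)) t₀ hΦ.hasFDerivAt
      ((hasDerivAt_id t₀).prodMk (hasDerivAt_const t₀ x₀))).deriv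
  have h2 : ∀ y, ⟪gradient (fun y => φ t₀ y) x₀, y⟫ = Φ' (0, y) := by
    intro y
    have h3 : HasFDerivAt (fun y => φ t₀ y) (Φ'.comp (ContinuousLinearMap.inr ℝ ℝ _)) x₀ :=
      HasFDerivAt.comp (f := fun y : EuclideanSpace ℝ (Fin d) => (t₀, y)) x₀ hΦ.hasFDerivAt
        (hasFDerivAt_prodMk_right t₀ x₀)
    rw [gradient, h3.fderiv, InnerProductSpace.toDual_symm_apply]
    rfl
  obtain ⟨ρ, hρ, h⟩ := Metric.eventually_nhds_iff.1 (hΦ.isLittleO.def hε)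
  refine ⟨ρ, hρ, fun t c x y ht hc hx hy => ?_⟩
  have h4 := @h ((c, y), (t, x)) (by
    simp only [Prod.dist_eq, max_lt_iff]
    simp only [dist_eq_norm]
    exact ⟨⟨hc, hy⟩, ht, hx⟩)
  have h5 : Φ' ((c, y) - (t, x)) = Φ' (1, 0) * (c - t) + Φ' (0, y - x) := by
    have : ((c, y) - (t, x) : ℝ × EuclideanSpace ℝ (Fin d)) = (c - t) • (1, 0) + (0, y - x) := by
      simp
    rw [this, map_add, map_smul, smul_eq_mul, mul_comm]
  rw [h1, h2, ← h5]
  refine h4.trans (mul_le_mul_of_nonneg_left ?_ hε.le)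
  rw [Prod.norm_def]
  exact max_le (le_add_of_nonneg_right (norm_nonneg _)) (le_add_of_nonneg_left (abs_nonneg _))

variable [Nonempty U] [Nonempty V]

/-- Along a short stage near a point where the equation is violated, the one-stage operator
decreases the test function at a linear rate. -/
theorem exists_step_le (hf : Regular f C K)
    (hφ : ContDiff ℝ 1 fun q : ℝ × EuclideanSpace ℝ (Fin d) => φ q.1 q.2)
    (hneg : deriv (fun s => φ s x₀) t₀ + ham U V f t₀ x₀ (gradient (fun y => φ t₀ y) x₀) < 0) :
    ∃ θ > 0, ∃ ρ > 0, ∀ (t c : ℝ) (x : EuclideanSpace ℝ (Fin d))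
      (w : EuclideanSpace ℝ (Fin d) → ℝ) (b M : ℝ), t₀ ≤ t → t < c → c ≤ T → c - t₀ < ρ →
      ‖x - x₀‖ + C * (c - t) < ρ → Continuous w → (∀ y, |w y| ≤ M) →
      (∀ y, ‖y - x‖ ≤ C * (c - t) → w y ≤ φ c y + b) →
      step f T t c w x ≤ φ t x + b - θ * (c - t) := by
  have hC : 0 ≤ C := hf.nonneg (Classical.arbitrary U) (Classical.arbitrary V)
  set a := deriv (fun s => φ s x₀) t₀
  set p := gradient (fun y => φ t₀ y) x₀
  set H := ham U V f t₀ x₀ p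
  obtain ⟨θ, hθ, hθH⟩ : ∃ θ > 0, a + H = -(4 * θ) := ⟨-(a + H) / 4, by linarith, by ring⟩
  obtain ⟨ε₁, hε₁, hε₁θ⟩ : ∃ ε₁ > 0, ε₁ * (1 + C) = θ :=
    ⟨θ / (1 + C), by positivity, by field_simp⟩
  obtain ⟨ε₂, hε₂, hε₂θ⟩ : ∃ ε₂ > 0, ‖p‖ * ε₂ ≤ θ := by
    refine ⟨θ / (1 + ‖p‖), by positivity, ?_⟩
    rw [mul_div_assoc', div_le_iff₀ (by positivity)]
    nlinarith [norm_nonneg p]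
  obtain ⟨ρ₁, hρ₁, hlin⟩ := exists_abs_sub_linear_le hφ t₀ x₀ hε₁
  obtain ⟨ρ₂, hρ₂, hclose⟩ := hf.exists_uniform_close t₀ x₀ hε₂
  refine ⟨θ, hθ, min ρ₁ ρ₂, lt_min hρ₁ hρ₂, ?_⟩
  intro t c x w b M ht htc hcT hc hx hwc hwM hw
  have hct : 0 < c - t := sub_pos.2 htc
  have hcI : c ∈ Icc t T := ⟨htc.le, hcT⟩
  have hCct : 0 ≤ C * (c - t) := by positivity
  refine le_of_forall_pos_le_add fun ε hε => ?_
  obtain ⟨u, hu, huv⟩ := exists_step_sub_le_cost (f := f) (T := T) (t := t) (c := c) (x := x) hwM hε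
  obtain ⟨v, hv⟩ := hf.exists_response_control (t₀ := t₀) (x₀ := x₀) (p := p) hu htc hθ
  set h : ℝ → I → ℝ := fun r z => ⟪p, f t₀ x₀ (u r z) v⟫ with hh
  have hcont : Continuous fun a => ⟪p, f t₀ x₀ a v⟫ := continuous_const.inner
    ((hf.continuous_pair t₀ x₀).comp (by fun_prop : Continuous fun a : U => (a, v)))
  have hhm : Measurable fun q : ℝ × I => h q.1 q.2 := hcont.measurable.comp hu
  have hhi : Integrable (fun q : ℝ × I => h q.1 q.2)
      ((volume.restrict (Ioc t c)).prod (volume : Measure I)) :=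
    Integrable.of_bound hhm.aestronglyMeasurable (‖p‖ * C)
      (Eventually.of_forall fun _ => hf.abs_inner_le _ _)
  have hvm : Measurable fun _ : ℝ => v := measurable_const
  have hpt : ∀ z : I, w (sol f T t x (fun r => u r z) (fun _ => v) c) ≤
      φ t x + b + (a * (c - t) + ((∫ r in Ioc t c, h r z) + θ * (c - t))) + θ * (c - t) := by
    intro z
    have hum : Measurable fun r => u r z := hu.comp measurable_prodMk_right
    set X := sol f T t x (fun r => u r z) (fun _ => v) with hX
    have hXle : ∀ r ∈ Icc t c, ‖X r - x‖ ≤ C * (c - t) := fun r hr =>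
      (hf.norm_sol_sub_le hum hvm ⟨hr.1, hr.2.trans hcT⟩).trans
        (mul_le_mul_of_nonneg_left (by linarith [hr.2]) hC)
    have hXx₀ : ∀ r ∈ Icc t c, ‖X r - x₀‖ < min ρ₁ ρ₂ := fun r hr => by
      have h1 : X r - x₀ = (X r - x) + (x - x₀) := by abel
      rw [h1]
      linarith [norm_add_le (X r - x) (x - x₀), hXle r hr]
    have hXc := hXle c ⟨htc.le, le_rfl⟩
    have h1 := hlin t c x (X c) (by
        rw [abs_of_nonneg (by linarith)]
        exact (by linarith : t - t₀ < min ρ₁ ρ₂).trans_le (min_le_left _ _))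
      (by
        rw [abs_of_nonneg (by linarith)]
        exact hc.trans_le (min_le_left _ _))
      ((by linarith : ‖x - x₀‖ < min ρ₁ ρ₂).trans_le (min_le_left _ _))
      ((hXx₀ c ⟨htc.le, le_rfl⟩).trans_le (min_le_left _ _))
    rw [abs_of_pos hct] at h1
    have h2 : ε₁ * (c - t + ‖X c - x‖) ≤ θ * (c - t) := by
      rw [← hε₁θ, mul_assoc]
      exact mul_le_mul_of_nonneg_left (by linarith) hε₁.le
    have hXm : AEStronglyMeasurable X (volume.restrict (Ioc t c)) :=
      ((hf.continuousOn_sol hum hvm).mono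
        (Ioc_subset_Icc_self.trans (Icc_subset_Icc_right hcT))).aestronglyMeasurable
        measurableSet_Ioc
    have hfi : Integrable (fun r => f r (X r) (u r z) v) (volume.restrict (Ioc t c)) := by
      refine Integrable.of_bound ?_ C (Eventually.of_forall fun _ => hf.bdd _ _ _ _)
      exact hf.cont.comp_aestronglyMeasurable
        (measurable_id.aestronglyMeasurable.prodMk (hXm.prodMk
          (hum.aestronglyMeasurable.prodMk hvm.aestronglyMeasurable)))
    have hhzi : Integrable (fun r => h r z) (volume.restrict (Ioc t c)) :=
      Integrable.of_bound (hhm.comp measurable_prodMk_right).aestronglyMeasurable (‖p‖ * C)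
        (Eventually.of_forall fun _ => hf.abs_inner_le _ _)
    have h3 : ⟪p, X c - x⟫ ≤ (∫ r in Ioc t c, h r z) + θ * (c - t) := by
      have h4 : X c - x = ∫ r in Ioc t c, f r (X r) (u r z) v := by
        rw [hX, hf.sol_eq hum hvm hcI, add_sub_cancel_left, intervalIntegral.integral_of_le htc.le]
      have h5 : ∫ r in Ioc t c, (h r z + θ) = (∫ r in Ioc t c, h r z) + θ * (c - t) := by
        rw [integral_add hhzi (integrable_const _), setIntegral_const, smul_eq_mul,
          measureReal_def, Real.volume_Ioc, ENNReal.toReal_ofReal hct.le, mul_comm]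
      rw [h4, ← integral_inner hfi, ← h5]
      refine setIntegral_mono_on (hfi.const_inner p) (hhzi.add (integrable_const _))
        measurableSet_Ioc fun r hr => ?_
      have hr' := Ioc_subset_Icc_self hr
      have h6 := hclose r (X r) (by
        rw [abs_of_nonneg (by linarith [hr.1])]
        exact (by linarith [hr.2] : r - t₀ < min ρ₁ ρ₂).trans_le (min_le_right _ _))
        ((hXx₀ r hr').trans_le (min_le_right _ _)) (u r z) v
      have h7 : ⟪p, f r (X r) (u r z) v⟫ - h r z ≤ θ := by
        rw [hh, ← inner_sub_right]
        exact (real_inner_le_norm _ _).trans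
          ((mul_le_mul_of_nonneg_left h6 (norm_nonneg _)).trans hε₂θ)
      linarith
    have h8 := (abs_le.1 h1).2
    linarith [hw (X c) hXc]
  have hhz_int : Integrable fun z : I => ∫ r in Ioc t c, h r z := hhi.integral_prod_right
  have h9 : cost f T t c w x u (fun _ => v) ≤
      φ t x + b + a * (c - t) + (c - t) * (H + θ) + 2 * (θ * (c - t)) := by
    calc cost f T t c w x u (fun _ => v)
        ≤ ∫ z : I, ((∫ r in Ioc t c, h r z) +
            (φ t x + b + a * (c - t) + 2 * (θ * (c - t)))) :=
          integral_mono (integrable_cost_integrand hf hwc hwM hcI hu hvm)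
            (hhz_int.add (integrable_const _)) fun z => (hpt z).trans_eq (by ring)
      _ = (∫ q, h q.1 q.2 ∂((volume.restrict (Ioc t c)).prod (volume : Measure I))) +
            (φ t x + b + a * (c - t) + 2 * (θ * (c - t))) := by
          rw [integral_add hhz_int (integrable_const _), integral_prod_symm _ hhi]
          simp
      _ ≤ _ := by linarith
  have h10 := huv (fun _ => v) hvm
  have h11 : a = -(4 * θ) - H := by linarith
  rw [h11] at h9
  nlinarith
end Viscosity

section Subsolution

set_option linter.unusedSectionVars false

variable {d : ℕ} {U V : Type} [MetricSpace U] [CompactSpace U] [MetricSpace V] [CompactSpace V]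
  [MeasurableSpace U] [BorelSpace U] [MeasurableSpace V] [BorelSpace V] [Nonempty U] [Nonempty V]
  {f : ℝ → EuclideanSpace ℝ (Fin d) → U → V → EuclideanSpace ℝ (Fin d)} {C : ℝ} {K L : ℝ≥0}
  {T t₀ M : ℝ} {g : EuclideanSpace ℝ (Fin d) → ℝ} {x₀ : EuclideanSpace ℝ (Fin d)}
  {P : Measure Omega} [IsProbabilityMeasure P]

theorem lowerValD_le_of_node_le {π : Partition T}
    (hP : IsProductMeasure P) (hf : Regular f C K) (hg : LipschitzWith L g)
    (hgM : ∀ y, |g y| ≤ M) {φ : ℝ → EuclideanSpace ℝ (Fin d) → ℝ} {θ ρ b : ℝ}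
    (hstep : ∀ t c x w b M, t₀ ≤ t → t < c → c ≤ T → c - t₀ < ρ →
      ‖x - x₀‖ + C * (c - t) < ρ → Continuous w → (∀ y, |w y| ≤ M) →
      (∀ y, ‖y - x‖ ≤ C * (c - t) → w y ≤ φ c y + b) →
      step f T t c w x ≤ φ t x + b - θ * (c - t))
    {k : ℕ} (hk : k ≤ π.n) (hkρ : π.t k - t₀ < ρ)
    (hnode : ∀ y, ‖y - x₀‖ < ρ → lowerValD U V f g P π (π.t k) y ≤ φ (π.t k) y + b)
    {j : ℕ} (hj : j ≤ k) :
    ∀ t ∈ Icc (π.t j) (π.t k), t₀ ≤ t → ∀ x, ‖x - x₀‖ + C * (π.t k - t) < ρ →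
      lowerValD U V f g P π t x ≤ φ t x + b - θ * (π.t k - t) := by
  induction hj using Nat.decreasingInduction with
  | self =>
    intro t ht _ x hx
    obtain rfl : t = π.t k := le_antisymm ht.2 ht.1
    rw [sub_self, mul_zero, add_zero] at hx
    simpa using hnode x hx
  | of_succ j hj ih =>
    intro t ht ht₀ x hx
    rcases le_or_gt (π.t (j + 1)) t with h | h
    · exact ih t ⟨h, ht.2⟩ ht₀ x hx
    · have hjn : j < π.n := hj.trans_le hk
      have hck : π.t (j + 1) ≤ π.t k := π.t_le hj hk
      have hreg := nodeRegular (f := f) (M := M) hP hf hg hgM (Nat.succ_le_of_lt hjn)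
      obtain ⟨L', hL'⟩ := hreg.lip
      have hC : 0 ≤ C := hf.nonneg (Classical.arbitrary U) (Classical.arbitrary V)
      rw [hreg.lowerValD_eq_step hP hf hg hgM hjn ⟨ht.1, h⟩]
      have h1 : C * (π.t k - t) = C * (π.t (j + 1) - t) + C * (π.t k - π.t (j + 1)) := by ring
      have h2 : 0 ≤ C * (π.t k - π.t (j + 1)) := mul_nonneg hC (by linarith)
      have := hstep t (π.t (j + 1)) x _ (b - θ * (π.t k - π.t (j + 1))) M ht₀ h
        (π.t_le_last hjn) (by linarith) (by linarith) hL'.continuous hreg.bdd fun y hy => by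
          have := ih (π.t (j + 1)) ⟨le_rfl, hck⟩ (by linarith) y (by
            have := norm_sub_le_norm_sub_add_norm_sub y x x₀
            linarith)
          linarith
      linarith

theorem viscosity_inequality_of_regular (hP : IsProductMeasure P) (hf : Regular f C K)
    (hg : LipschitzWith L g) (hgM : ∀ y, |g y| ≤ M) {prt : ℕ → Partition T}
    (hmesh : Tendsto (fun n => (prt n).mesh) atTop (𝓝 0))
    {W : ℝ → EuclideanSpace ℝ (Fin d) → ℝ}
    (hconv : ∀ K : Set (ℝ × EuclideanSpace ℝ (Fin d)),
      IsCompact K → K ⊆ Icc (0 : ℝ) T ×ˢ univ →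
      TendstoUniformlyOn (fun n q => lowerValD U V f g P (prt n) q.1 q.2)
        (fun q => W q.1 q.2) atTop K)
    {φ : ℝ → EuclideanSpace ℝ (Fin d) → ℝ}
    (hφ : ContDiff ℝ 1 fun q : ℝ × EuclideanSpace ℝ (Fin d) => φ q.1 q.2)
    (ht₀ : t₀ ∈ Ico 0 T)
    (hmax : IsLocalMaxOn (fun q : ℝ × EuclideanSpace ℝ (Fin d) => W q.1 q.2 - φ q.1 q.2)
      (Icc 0 T ×ˢ univ) (t₀, x₀)) :
    0 ≤ deriv (fun s => φ s x₀) t₀ + ham U V f t₀ x₀ (gradient (fun y => φ t₀ y) x₀) := by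
  by_contra! hneg
  have hC : 0 ≤ C := hf.nonneg (Classical.arbitrary U) (Classical.arbitrary V)
  obtain ⟨θ, hθ, ρ₁, hρ₁, hstep⟩ := exists_step_le (T := T) hf hφ hneg
  obtain ⟨ρ₂, hρ₂, hball⟩ := Metric.mem_nhdsWithin_iff.1 hmax
  have hlocal : ∀ t y, t ∈ Icc 0 T → |t - t₀| < ρ₂ → ‖y - x₀‖ < ρ₂ →
      W t y - φ t y ≤ W t₀ x₀ - φ t₀ x₀ := fun t y ht h1 h2 => by
    have hmem : (t, y) ∈ Metric.ball (t₀, x₀) ρ₂ := by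
      rw [Metric.mem_ball, Prod.dist_eq, max_lt_iff, Real.dist_eq, dist_eq_norm]
      exact ⟨h1, h2⟩
    exact hball ⟨hmem, ht, mem_univ _⟩
  obtain ⟨ρ, hρ, hρm⟩ := exists_between (lt_min hρ₁ hρ₂)
  have hρρ₁ : ρ < ρ₁ := hρm.trans_le (min_le_left _ _)
  have hρρ₂ : ρ < ρ₂ := hρm.trans_le (min_le_right _ _)
  obtain ⟨δ, hδ, hδm⟩ := exists_between
    (lt_min (lt_min hρ (sub_pos.2 ht₀.2)) (div_pos hρ (by linarith : 0 < C + 1)))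
  have hδρ : δ < ρ := hδm.trans_le ((min_le_left _ _).trans (min_le_left _ _))
  have hδT : δ < T - t₀ := hδm.trans_le ((min_le_left _ _).trans (min_le_right _ _))
  have hδC : δ * (C + 1) < ρ :=
    (lt_div_iff₀ (by linarith)).1 (hδm.trans_le (min_le_right _ _))
  have hu := hconv (Icc t₀ (t₀ + δ) ×ˢ Metric.closedBall x₀ ρ)
    (isCompact_Icc.prod (isCompact_closedBall _ _))
    (prod_mono (Icc_subset_Icc ht₀.1 (by linarith)) (subset_univ _))
  obtain ⟨n, hn, hnm⟩ := ((Metric.tendstoUniformlyOn_iff.1 hu (θ * δ / 8) (by positivity)).and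
    (hmesh.eventually_lt_const (half_pos hδ))).exists
  set π := prt n with hπ
  set k := π.idx (t₀ + δ) with hk
  have hkn : k < π.n := π.idx_lt _
  have h1 : π.t k ≤ t₀ + δ := π.t_idx_le (by linarith [ht₀.1])
  have h2 : t₀ + δ < π.t (k + 1) := π.lt_t_idx_succ (by linarith)
  have h3 := π.sub_le_mesh hkn
  have hnode : ∀ y, ‖y - x₀‖ < ρ → lowerValD U V f g P π (π.t k) y ≤
      φ (π.t k) y + (W t₀ x₀ - φ t₀ x₀ + θ * δ / 8) := by
    intro y hy
    have h4 := hn (π.t k, y) ⟨⟨by linarith, h1⟩, by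
      rw [Metric.mem_closedBall, dist_eq_norm]; exact hy.le⟩
    have h5 := hlocal (π.t k) y ⟨π.t_nonneg hkn.le, π.t_le_last hkn.le⟩
      (by rw [abs_of_nonneg (by linarith)]; linarith) (hy.trans hρρ₂)
    rw [Real.dist_eq, abs_lt] at h4
    linarith [h4.1]
  have hCk : C * (π.t k - t₀) ≤ C * δ := mul_le_mul_of_nonneg_left (by linarith) hC
  have h6 := lowerValD_le_of_node_le hP hf hg hgM
    (fun t c x w b M ha hb hc hd he => hstep t c x w b M ha hb hc (hd.trans hρρ₁)
      (he.trans hρρ₁)) hkn.le (by linarith) hnode (Nat.zero_le k) t₀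
    ⟨by rw [π.map_zero]; exact ht₀.1, by linarith⟩ le_rfl x₀ (by
      rw [sub_self, norm_zero]
      linarith)
  have h7 := hn (t₀, x₀) ⟨⟨le_rfl, by linarith⟩, Metric.mem_closedBall_self hρ.le⟩
  rw [Real.dist_eq, abs_lt] at h7
  have h8 : θ * (δ / 2) ≤ θ * (π.t k - t₀) := mul_le_mul_of_nonneg_left (by linarith) hθ.le
  have h9 : 0 < θ * δ := mul_pos hθ hδ
  linarith [h7.2]

theorem isViscSubsol_of_regular (hT : 0 ≤ T) (hP : IsProductMeasure P) (hf : Regular f C K)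
    (hg : LipschitzWith L g) (hgM : ∀ y, |g y| ≤ M) {prt : ℕ → Partition T}
    (hmesh : Tendsto (fun n => (prt n).mesh) atTop (𝓝 0))
    {W : ℝ → EuclideanSpace ℝ (Fin d) → ℝ}
    (hconv : ∀ K : Set (ℝ × EuclideanSpace ℝ (Fin d)),
      IsCompact K → K ⊆ Icc (0 : ℝ) T ×ˢ univ →
      TendstoUniformlyOn (fun n q => lowerValD U V f g P (prt n) q.1 q.2)
        (fun q => W q.1 q.2) atTop K) :
    IsViscSubsol U V f g T W := by
  refine ⟨fun x => ?_, fun φ hφ t x ht hmax =>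
    viscosity_inequality_of_regular hP hf hg hgM hmesh hconv hφ ht hmax⟩
  have h := (hconv {(T, x)} isCompact_singleton
    (singleton_subset_iff.2 ⟨⟨hT, le_rfl⟩, mem_univ _⟩)).tendsto_at (mem_singleton _)
  simp only [lowerValD_terminal hT hf hg.continuous hgM] at h
  exact (tendsto_nhds_unique h tendsto_const_nhds).le

end Subsolution

section Extension

set_option linter.unusedSectionVars false

variable {d : ℕ} {U V : Type} [MetricSpace U] [MetricSpace V] [MeasurableSpace U]
  [MeasurableSpace V]
  {f F : ℝ → EuclideanSpace ℝ (Fin d) → U → V → EuclideanSpace ℝ (Fin d)}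
  {T t : ℝ} {g : EuclideanSpace ℝ (Fin d) → ℝ} {x : EuclideanSpace ℝ (Fin d)}

theorem isSol_congr (h : ∀ s ∈ Icc t T, f s = F s) {u : ℝ → U} {v : ℝ → V} :
    IsSol f T t x u v = IsSol F T t x u v := by
  refine funext fun X => propext (and_congr_right fun _ => forall₂_congr fun s hs => ?_)
  rw [intervalIntegral.integral_congr fun r hr => ?_]
  rw [uIcc_of_le hs.1] at hr
  rw [h r ⟨hr.1, hr.2.trans hs.2⟩]

theorem lowerValD_congr [Nonempty U] [Nonempty V] {P : Measure Omega} {π : Partition T}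
    (h : ∀ s ∈ Icc t T, f s = F s) :
    lowerValD U V f g P π t x = lowerValD U V F g P π t x := by
  have hp : payoff f g P π t x = payoff F g P π t x := by
    unfold payoff solStrat sol
    simp_rw [isSol_congr h]
  unfold lowerValD lowerVal IsLowerVal
  rw [hp]

theorem ham_congr (h : f t = F t) (p : EuclideanSpace ℝ (Fin d)) :
    ham U V f t x p = ham U V F t x p := by
  unfold ham ftilde
  rw [h]

theorem regular_projIcc {C : ℝ} {K : ℝ≥0} (hT : 0 ≤ T) (hbdd : ∀ t x u v, ‖f t x u v‖ ≤ C)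
    (hcont : ContinuousOn
      (fun q : ℝ × EuclideanSpace ℝ (Fin d) × U × V => f q.1 q.2.1 q.2.2.1 q.2.2.2)
      (Icc (0 : ℝ) T ×ˢ univ))
    (hlip : ∀ t u v, LipschitzWith K fun x => f t x u v) :
    Regular (fun t => f (projIcc 0 T hT t)) C K where
  cont := hcont.comp_continuous
    (f := fun q : ℝ × EuclideanSpace ℝ (Fin d) × U × V => ((projIcc 0 T hT q.1 : ℝ), q.2))
    ((continuous_subtype_val.comp (continuous_projIcc.comp continuous_fst)).prodMk continuous_snd)
    fun _ => ⟨Subtype.prop _, mem_univ _⟩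
  bdd _ := hbdd _
  lip _ := hlip _

end Extension

/-- **Lemma 4.2.** If the lower value functions `V^{Π_n}` along a sequence of
partitions with vanishing mesh converge uniformly on compacts to a function `V`, then `V` is a
viscosity subsolution of the Hamilton–Jacobi–Isaacs equation
`∂_t W + sup_{μ ∈ ΔU} inf_{ν ∈ ΔV} f̃(t,x,μ,ν)·∇W = 0`, `W(T,·) = g`. -/
theorem statement_13
    {d : ℕ} {U V : Type} [MetricSpace U] [CompactSpace U] [MetricSpace V] [CompactSpace V]
    [MeasurableSpace U] [BorelSpace U] [MeasurableSpace V] [BorelSpace V]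
    [Nonempty U] [Nonempty V]
    (T : ℝ) (hT : 0 < T)
    (f : ℝ → EuclideanSpace ℝ (Fin d) → U → V → EuclideanSpace ℝ (Fin d))
    (hf_bdd : ∃ C : ℝ, ∀ t x u v, ‖f t x u v‖ ≤ C)
    (hf_cont : ContinuousOn
      (fun q : ℝ × EuclideanSpace ℝ (Fin d) × U × V => f q.1 q.2.1 q.2.2.1 q.2.2.2)
      (Icc (0 : ℝ) T ×ˢ univ))
    (hf_lip : ∃ K : ℝ≥0, ∀ t u v, LipschitzWith K fun x => f t x u v)
    (g : EuclideanSpace ℝ (Fin d) → ℝ)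
    (hg_bdd : ∃ C : ℝ, ∀ x, |g x| ≤ C)
    (hg_lip : ∃ K : ℝ≥0, LipschitzWith K g)
    (P : Measure Omega) [IsProbabilityMeasure P] (hP : IsProductMeasure P)
    (prt : ℕ → Partition T)
    (hmesh : Tendsto (fun n => (prt n).mesh) atTop (𝓝 0))
    (W : ℝ → EuclideanSpace ℝ (Fin d) → ℝ)
    (hconv : ∀ K : Set (ℝ × EuclideanSpace ℝ (Fin d)),
      IsCompact K → K ⊆ Icc (0 : ℝ) T ×ˢ univ →
      TendstoUniformlyOn (fun n q => lowerValD U V f g P (prt n) q.1 q.2)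
        (fun q => W q.1 q.2) atTop K) :
    IsViscSubsol U V f g T W := by
  obtain ⟨C, hC⟩ := hf_bdd
  obtain ⟨K, hK⟩ := hf_lip
  obtain ⟨M, hM⟩ := hg_bdd
  obtain ⟨L, hL⟩ := hg_lip
  have hF := regular_projIcc hT.le hC hf_cont hK
  have hfF : ∀ s ∈ Icc 0 T, f s = f (projIcc 0 T hT.le s) := fun s hs => by
    rw [projIcc_of_mem hT.le hs]
  obtain ⟨h1, h2⟩ := isViscSubsol_of_regular hT.le hP hF hL hM hmesh fun A hA hAT =>
    (hconv A hA hAT).congr (Eventually.of_forall fun n q hq =>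
      lowerValD_congr fun s hs => hfF s ⟨(hAT hq).1.1.trans hs.1, hs.2⟩)
  refine ⟨h1, fun φ hφ t x ht hmax => ?_⟩
  rw [ham_congr (F := fun t => f (projIcc 0 T hT.le t)) (hfF t ⟨ht.1, ht.2.le⟩)]
  exact h2 φ hφ t x ht hmax

end DGameFormal
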